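/- For every k ≥ 1 and every ε > 0 there exist constants r = r(k, ε) and Q = Q(k, ε) with the following property. If A_1, …, A_k are finite abelian groups and φ : A_1 × ⋯ × A_k → ℝ/ℤ is a multilinear map with bias(φ) ≥ ε, then φ can be written as a sum of at most r multilinear maps A_1 × ⋯ × A_k → ℝ/ℤ, each of which factors through m_q for some prime power q ≤ Q. -/

import Mathlib

open scoped ComplexOrder

/-- A map of (dependent) products of abelian groups is multiadditive (multilinear over ℤ)
if it is additive in each coordinate separately. -/
def IsMultiadditive {ι : Type} [DecidableEq ι] {A : ι → Type} [∀ i, AddCommGroup (A i)]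
    {B : Type} [AddCommMonoid B] (φ : (∀ i, A i) → B) : Prop :=
  ∀ (i : ι) (x : ∀ j, A j) (a b : A i),
    φ (Function.update x i (a + b)) = φ (Function.update x i a) + φ (Function.update x i b)

/-- The standard character `e(x) = exp(2πix)` of `ℝ/ℤ`. -/
noncomputable def eChar (x : AddCircle (1 : ℝ)) : ℂ := AddCircle.toCircle x

/-- The bias of a map `A_1 × ⋯ × A_k → ℝ/ℤ`. -/
noncomputable def bias {ι : Type} [Fintype ι] [DecidableEq ι] {A : ι → Type}
    [∀ i, Fintype (A i)] (φ : (∀ i, A i) → AddCircle (1 : ℝ)) : ℂ :=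
  (∑ x : ∀ i, A i, eChar (φ x)) / (Fintype.card (∀ i, A i) : ℂ)

/-- The bilinear map `m_q : ℤ/q × ℤ/q → ℝ/ℤ`, `(x, y) ↦ xy/q mod 1`. -/
noncomputable def mq (q : ℕ) (x y : ZMod q) : AddCircle (1 : ℝ) :=
  (((x.val * y.val : ℕ) : ℝ) / q : ℝ)

/-- A multilinear map `φ : A_1 × ⋯ × A_k → ℝ/ℤ` factors through `m_q` if
`φ(x) = m_q(φ₁(x_I), φ₂(x_{I^c}))` for some `I` with `0 < |I| < k` and multilinear `φ₁, φ₂`. -/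
def FactorsThroughMq {ι : Type} [Fintype ι] [DecidableEq ι] {A : ι → Type}
    [∀ i, AddCommGroup (A i)] (q : ℕ) (φ : (∀ i, A i) → AddCircle (1 : ℝ)) : Prop :=
  ∃ I : Finset ι, I.Nonempty ∧ I ≠ Finset.univ ∧
    ∃ (φ₁ : (∀ i : I, A i) → ZMod q) (φ₂ : (∀ i : (Iᶜ : Finset ι), A i) → ZMod q),
      IsMultiadditive φ₁ ∧ IsMultiadditive φ₂ ∧
      ∀ x : ∀ i, A i, φ x = mq q (φ₁ (fun i => x i)) (φ₂ (fun i => x i))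

set_option linter.unusedSectionVars false

namespace BiasInverse

open Finset Function

open scoped Classical

section Forms

variable {ι : Type} [Fintype ι] [DecidableEq ι] {V : ι → Type} [∀ i, AddCommGroup (V i)]
  [∀ i, Fintype (V i)] {B : Type} [AddCommGroup B]

/-- `f` is additive in each coordinate of `J` and does not depend on the other coordinates. -/
def IsForm (J : Finset ι) (f : (∀ i, V i) → B) : Prop :=
  (∀ i ∈ J, ∀ x (a b : V i), f (update x i (a + b)) = f (update x i a) + f (update x i b)) ∧
    ∀ i ∉ J, ∀ x (a : V i), f (update x i a) = f x

/-- The unnormalised exponential sum of `f` with respect to the character `χ`. -/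
noncomputable def expSum (χ : AddChar B Circle) (f : (∀ i, V i) → B) : ℂ :=
  ∑ x, (χ (f x) : ℂ)

/-- The number of points of the domain satisfying `P`. -/
noncomputable def count (P : (∀ i, V i) → Prop) : ℝ := ((univ.filter P).card : ℝ)

variable (V) in
/-- The number of points of the domain. -/
noncomputable def size : ℝ := (Fintype.card (∀ i, V i) : ℝ)

theorem IsForm.zero (J : Finset ι) : IsForm J (0 : (∀ i, V i) → B) := by
  constructor <;> simp

theorem IsForm.add {J : Finset ι} {f g : (∀ i, V i) → B} (hf : IsForm J f) (hg : IsForm J g) :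
    IsForm J (f + g) := by
  refine ⟨fun i hi x a b => ?_, fun i hi x a => ?_⟩
  · simp only [Pi.add_apply, hf.1 i hi, hg.1 i hi]; abel
  · simp only [Pi.add_apply, hf.2 i hi, hg.2 i hi]

theorem IsForm.sum {J : Finset ι} {α : Type*} (s : Finset α) {f : α → (∀ i, V i) → B}
    (hf : ∀ l ∈ s, IsForm J (f l)) : IsForm J (∑ l ∈ s, f l) :=
  Finset.sum_induction f (IsForm J) (fun _ _ => IsForm.add) (IsForm.zero J) hf

theorem IsForm.hom {J : Finset ι} {C : Type} [AddCommGroup C] (h : B →+ C)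
    {f : (∀ i, V i) → B} (hf : IsForm J f) : IsForm J (fun x => h (f x)) := by
  refine ⟨fun i hi x a b => ?_, fun i hi x a => ?_⟩
  · simp only [hf.1 i hi, map_add]
  · simp only [hf.2 i hi]

theorem IsForm.mul {R : Type} [CommRing R] {J K : Finset ι} (h : Disjoint J K)
    {f g : (∀ i, V i) → R} (hf : IsForm J f) (hg : IsForm K g) : IsForm (J ∪ K) (f * g) := by
  refine ⟨fun i hi x a b => ?_, fun i hi x a => ?_⟩
  · simp only [Pi.mul_apply]
    rcases mem_union.1 hi with hJ | hK
    · have hK := Finset.disjoint_left.1 h hJ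
      rw [hf.1 i hJ, hg.2 i hK, hg.2 i hK, hg.2 i hK, add_mul]
    · have hJ := Finset.disjoint_right.1 h hK
      rw [hg.1 i hK, hf.2 i hJ, hf.2 i hJ, hf.2 i hJ, mul_add]
  · simp only [mem_union, not_or] at hi
    simp only [Pi.mul_apply, hf.2 i hi.1, hg.2 i hi.2]

theorem IsForm.slice {J : Finset ι} {f : (∀ i, V i) → B} (hf : IsForm J f) (i : ι) (y : V i) :
    IsForm (J.erase i) (fun x => f (update x i y)) := by
  refine ⟨fun j hj x a b => ?_, fun j hj x a => ?_⟩
  · obtain ⟨hji, hj⟩ := mem_erase.1 hj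
    simp only [update_comm hji, hf.1 j hj]
  · by_cases hji : j = i
    · subst hji; simp
    · simp only [mem_erase, not_and] at hj
      simp only [update_comm hji, hf.2 j (hj hji)]

theorem IsForm.congr_of_eqOn {J : Finset ι} {f : (∀ i, V i) → B} (hf : IsForm J f)
    {x y : ∀ i, V i} (h : ∀ i ∈ J, x i = y i) : f x = f y := by
  have key : ∀ T : Finset ι, Disjoint T J → f (T.piecewise y x) = f x := by
    intro T
    induction T using Finset.induction_on with
    | empty => simp
    | insert i T hi ih =>
      intro hT
      rw [disjoint_insert_left] at hT
      rw [piecewise_insert, hf.2 i hT.1, ih hT.2]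
  rw [← key Jᶜ disjoint_compl_left]
  congr 1
  ext i
  by_cases hi : i ∈ J <;> simp [hi, h]

theorem IsForm.slice_add {J : Finset ι} {f : (∀ i, V i) → B} (hf : IsForm J f) {i : ι}
    (hi : i ∈ J) (y z : V i) :
    (fun x => f (update x i (y + z))) =
      (fun x => f (update x i y)) + fun x => f (update x i z) := by
  ext x; exact hf.1 i hi x y z

theorem count_eq (P : (∀ i, V i) → Prop) [DecidablePred P] :
    count P = ((univ.filter P).card : ℝ) := by
  unfold count; congr!

theorem sum_update {M : Type*} [AddCommMonoid M] (i : ι) (F : (∀ i, V i) → M) :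
    ∑ x, ∑ y : V i, F (update x i y) = Fintype.card (V i) • ∑ x, F x := by
  have h1 : ∑ x, ∑ y : V i, F (update x i y) =
      ∑ z : (∀ i, V i) × V i, F (update z.1 i z.2) := by
    rw [Fintype.sum_prod_type]
  have h2 : ∑ z : (∀ i, V i) × V i, F (update z.1 i z.2) = ∑ z : (∀ i, V i) × V i, F z.1 := by
    have hinv : Function.Involutive
        (fun z : (∀ i, V i) × V i => ((update z.1 i z.2, z.1 i) : (∀ i, V i) × V i)) := by
      intro z; simp
    exact Fintype.sum_equiv hinv.toPerm _ _ (fun z => rfl)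
  rw [h1, h2, Fintype.sum_prod_type]
  simp [Finset.sum_nsmul]

theorem size_pos : 0 < size V := by
  unfold size; exact_mod_cast Fintype.card_pos

theorem norm_expSum_le (χ : AddChar B Circle) (f : (∀ i, V i) → B) :
    ‖expSum χ f‖ ≤ size V := by
  unfold expSum size
  refine (norm_sum_le _ _).trans ?_
  simp only [Circle.norm_coe, sum_const, card_univ, nsmul_eq_mul, mul_one, le_refl]

theorem count_mono {P Q : (∀ i, V i) → Prop} (h : ∀ x, P x → Q x) : count P ≤ count Q := by
  unfold count
  exact_mod_cast card_le_card (monotone_filter_right _ (fun x _ => h x))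

/-- The character sum over one coordinate. -/
theorem sum_coord (χ : AddChar B Circle) {f : (∀ i, V i) → B} {i : ι}
    (hf : ∀ x (a b : V i), f (update x i (a + b)) = f (update x i a) + f (update x i b))
    (x : ∀ i, V i) :
    ∑ y : V i, (χ (f (update x i y)) : ℂ) =
      if ∀ v : V i, χ (f (update x i v)) = 1 then (Fintype.card (V i) : ℂ) else 0 := by
  let g : V i →+ B := AddMonoidHom.mk' (fun y => f (update x i y)) (hf x)
  let ψ : AddChar (V i) ℂ := Circle.coeHom.compAddChar (χ.compAddMonoidHom g)
  have := AddChar.sum_eq_ite ψ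
  have h2 : ψ = 0 ↔ ∀ v : V i, χ (f (update x i v)) = 1 := by
    rw [AddChar.eq_zero_iff]
    refine forall_congr' fun v => ?_
    change ((χ (f (update x i v)) : ℂ) = 1) ↔ _
    rw [← Circle.coe_one, Circle.coe_inj]
  simp only [h2] at this
  exact this

theorem card_mul_expSum (χ : AddChar B Circle) (i : ι) (f : (∀ i, V i) → B) :
    (Fintype.card (V i) : ℂ) * expSum χ f = ∑ x, ∑ y : V i, (χ (f (update x i y)) : ℂ) := by
  rw [sum_update i (fun x => (χ (f x) : ℂ)), nsmul_eq_mul, expSum]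

theorem expSum_eq_count (χ : AddChar B Circle) {f : (∀ i, V i) → B} {i : ι}
    (hf : ∀ x (a b : V i), f (update x i (a + b)) = f (update x i a) + f (update x i b)) :
    expSum χ f = (count (fun x => ∀ v : V i, χ (f (update x i v)) = 1) : ℂ) := by
  have hc : (Fintype.card (V i) : ℂ) ≠ 0 := by exact_mod_cast Fintype.card_ne_zero
  apply mul_left_cancel₀ hc
  rw [card_mul_expSum, Finset.sum_congr rfl (fun x _ => sum_coord χ hf x), count_eq]
  rw [Finset.sum_ite]
  simp [mul_comm]

theorem norm_expSum_add_le_of_indep (χ : AddChar B Circle) {f b : (∀ i, V i) → B} {i : ι}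
    (hf : ∀ x (a b : V i), f (update x i (a + b)) = f (update x i a) + f (update x i b))
    (hb : ∀ x (a : V i), b (update x i a) = b x) :
    ‖expSum χ (f + b)‖ ≤ ‖expSum χ f‖ := by
  have hc : (0 : ℝ) < (Fintype.card (V i) : ℝ) := by exact_mod_cast Fintype.card_pos
  have h1 : (Fintype.card (V i) : ℂ) * expSum χ (f + b) =
      ∑ x, (χ (b x) : ℂ) * ∑ y : V i, (χ (f (update x i y)) : ℂ) := by
    rw [card_mul_expSum]
    refine Finset.sum_congr rfl fun x _ => ?_
    rw [Finset.mul_sum]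
    refine Finset.sum_congr rfl fun y _ => ?_
    rw [Pi.add_apply, hb, AddChar.map_add_eq_mul, Circle.coe_mul, mul_comm]
  have h2 : ‖(Fintype.card (V i) : ℂ) * expSum χ (f + b)‖ ≤
      Fintype.card (V i) * count (fun x => ∀ v : V i, χ (f (update x i v)) = 1) := by
    rw [h1]
    refine (norm_sum_le _ _).trans ?_
    have : ∀ x, ‖(χ (b x) : ℂ) * ∑ y : V i, (χ (f (update x i y)) : ℂ)‖ =
        if ∀ v : V i, χ (f (update x i v)) = 1 then (Fintype.card (V i) : ℝ) else 0 := by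
      intro x
      rw [norm_mul, Circle.norm_coe, one_mul, sum_coord χ hf x]
      split_ifs <;> simp
    rw [Finset.sum_congr rfl (fun x _ => this x), Finset.sum_ite, count_eq]
    simp [mul_comm]
  rw [norm_mul, Complex.norm_natCast] at h2
  rw [expSum_eq_count χ hf, Complex.norm_real]
  exact (le_of_mul_le_mul_left h2 hc).trans (le_abs_self _)

theorem norm_expSum_add_sum_le (χ : AddChar B Circle) {J : Finset ι} {θ : (∀ i, V i) → B}
    (hθ : IsForm J θ) {α : Type*} (s : Finset α) (I : α → Finset ι) (g : α → (∀ i, V i) → B)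
    (hg : ∀ l ∈ s, IsForm (I l) (g l)) (hI : ∀ l ∈ s, ¬ J ⊆ I l) :
    ‖expSum χ (θ + ∑ l ∈ s, g l)‖ ≤ ‖expSum χ θ‖ := by
  have key : ∀ T : Finset ι, T ⊆ J →
      ‖expSum χ (θ + ∑ l ∈ s, g l)‖ ≤ ‖expSum χ (θ + ∑ l ∈ s with T ⊆ I l, g l)‖ := by
    intro T
    induction T using Finset.induction_on with
    | empty => simp
    | insert i T hi ih =>
      intro hT
      rw [insert_subset_iff] at hT
      refine (ih hT.2).trans ?_
      have hsplit : θ + ∑ l ∈ s with T ⊆ I l, g l =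
          (θ + ∑ l ∈ s with insert i T ⊆ I l, g l) +
            ∑ l ∈ s with (T ⊆ I l ∧ i ∉ I l), g l := by
        rw [add_assoc]
        congr 1
        rw [← Finset.sum_filter_add_sum_filter_not (s.filter (fun l => T ⊆ I l)) (fun l => i ∈ I l),
          Finset.filter_filter, Finset.filter_filter]
        congr 2
        ext l; simp only [mem_filter, insert_subset_iff, and_comm]
      rw [hsplit]
      refine norm_expSum_add_le_of_indep χ (i := i) ?_ ?_
      · intro x a b
        simp only [Pi.add_apply, Finset.sum_apply]
        rw [hθ.1 i hT.1, Finset.sum_congr rfl (fun l hl => (hg l (mem_filter.1 hl).1).1 i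
          (Finset.mem_of_subset (mem_filter.1 hl).2 (mem_insert_self _ _)) x a b),
          Finset.sum_add_distrib]
        abel
      · intro x a
        simp only [Finset.sum_apply]
        exact Finset.sum_congr rfl fun l hl => (hg l (mem_filter.1 hl).1).2 i
          (mem_filter.1 hl).2.2 x a
  have := key J subset_rfl
  rwa [Finset.filter_false_of_mem hI, Finset.sum_empty, add_zero] at this

theorem IsForm.norm_expSum (χ : AddChar B Circle) {J : Finset ι} {f : (∀ i, V i) → B}
    (hf : IsForm J f) {i : ι} (hi : i ∈ J) :
    ‖expSum χ f‖ = count (fun x => ∀ v : V i, χ (f (update x i v)) = 1) := by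
  rw [expSum_eq_count χ (hf.1 i hi), Complex.norm_real]
  exact abs_of_nonneg (Nat.cast_nonneg _)

/-- Many slices of a biased function are biased. -/
theorem dense_slices (χ : AddChar B Circle) (i : ι) (f : (∀ i, V i) → B) {ε : ℝ}
    (h : ε * size V ≤ ‖expSum χ f‖) :
    ε / 2 * Fintype.card (V i) ≤
      ((univ.filter fun y : V i =>
        ε / 2 * size V ≤ ‖expSum χ (fun x => f (update x i y))‖).card : ℝ) := by
  set S := univ.filter fun y : V i =>
        ε / 2 * size V ≤ ‖expSum χ (fun x => f (update x i y))‖ with hS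
  rcases le_or_gt ε 0 with hε | hε
  · refine le_trans ?_ (Nat.cast_nonneg _)
    have : (0 : ℝ) ≤ Fintype.card (V i) := Nat.cast_nonneg _
    nlinarith
  have h1 : (Fintype.card (V i) : ℝ) * ‖expSum χ f‖ ≤
      ∑ y : V i, ‖expSum χ (fun x => f (update x i y))‖ := by
    have := card_mul_expSum χ i f
    rw [Finset.sum_comm] at this
    rw [← Complex.norm_natCast, ← norm_mul, this]
    exact norm_sum_le _ _
  have h2 : ∑ y : V i, ‖expSum χ (fun x => f (update x i y))‖ ≤
      ∑ y : V i, (ε / 2 * size V + if y ∈ S then size V else 0) := by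
    refine Finset.sum_le_sum fun y _ => ?_
    split_ifs with hy
    · have := norm_expSum_le χ (fun x => f (update x i y))
      have := size_pos (V := V)
      nlinarith
    · simp only [hS, mem_filter, mem_univ, true_and, not_le] at hy
      linarith
  rw [Finset.sum_add_distrib, Finset.sum_ite_mem] at h2
  simp only [sum_const, card_univ, nsmul_eq_mul, univ_inter] at h2
  have hs := size_pos (V := V)
  have h3 : (Fintype.card (V i) : ℝ) * (ε * size V) ≤
      Fintype.card (V i) * (ε / 2 * size V) + S.card * size V :=
    (mul_le_mul_of_nonneg_left h (Nat.cast_nonneg _)).trans (h1.trans h2)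
  refine le_of_mul_le_mul_right ?_ hs
  linarith

end Forms

theorem index_le_of_dense {W : Type} [AddCommGroup W] [Fintype W] (T : AddSubgroup W)
    (S : Finset W) (hST : ∀ y ∈ S, y ∈ T) {ε : ℝ} (hε : 0 < ε)
    (hS : ε / 2 * Fintype.card W ≤ (S.card : ℝ)) : (T.index : ℝ) ≤ 2 / ε := by
  have h1 : S.card ≤ Nat.card T := by
    rw [Nat.card_eq_fintype_card, Fintype.card_subtype]
    exact card_le_card fun y hy => by simpa using hST y hy
  have h2 := T.card_mul_index
  rw [Nat.card_eq_fintype_card (α := W)] at h2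
  have hW : (0 : ℝ) < Fintype.card W := by exact_mod_cast Fintype.card_pos
  have h3 : (Nat.card T : ℝ) * T.index = Fintype.card W := by exact_mod_cast h2
  have h4 : ε / 2 * Fintype.card W ≤ Nat.card T := hS.trans (by exact_mod_cast h1)
  rw [le_div_iff₀ hε]
  have h5 : ε / 2 * Fintype.card W * T.index ≤ Fintype.card W := by
    rw [← h3]
    have : (0 : ℝ) ≤ T.index := Nat.cast_nonneg _
    rw [h3]
    calc ε / 2 * Fintype.card W * T.index ≤ Nat.card T * T.index := by gcongr
      _ = _ := h3
  have h6 : (ε / 2 * T.index) * Fintype.card W ≤ 1 * Fintype.card W := by linarith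
  have := le_of_mul_le_mul_right h6 hW
  linarith

section Cube

variable {α F : Type} [Fintype α]

/-- The points which agree with `b` outside of `s`. -/
noncomputable def cube [Fintype F] (s : Finset α) (b : α → F) : Finset (α → F) :=
  Fintype.piFinset fun j => if j ∈ s then univ else {b j}

theorem mem_cube [Fintype F] {s : Finset α} {b t : α → F} :
    t ∈ cube s b ↔ ∀ j ∉ s, t j = b j := by
  simp only [cube, Fintype.mem_piFinset]
  refine forall_congr' fun j => ?_
  by_cases hj : j ∈ s <;> simp [hj]

theorem card_cube [Fintype F] (s : Finset α) (b : α → F) :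
    (cube s b).card = Fintype.card F ^ s.card := by
  rw [cube, Fintype.card_piFinset, ← Finset.prod_subset (subset_univ s)]
  · rw [Finset.prod_congr rfl (g := fun _ => Fintype.card F), prod_const]
    intro j hj; simp [hj]
  · intro j _ hj; simp [hj]

/-- The square-free polynomial with coefficients `c`. -/
noncomputable def polyEval [CommRing F] (c : Finset α → F) (t : α → F) : F :=
  ∑ m, c m * ∏ j ∈ m, t j

theorem polyEval_update [CommRing F] (c : Finset α → F) (t : α → F) (j : α) :
    polyEval c (update t j (t j + 1)) =
      polyEval c t + polyEval (fun m => if j ∈ m then 0 else c (insert j m)) t := by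
  have h1 : ∀ m : Finset α, c m * ∏ i ∈ m, update t j (t j + 1) i =
      c m * ∏ i ∈ m, t i + if j ∈ m then c m * ∏ i ∈ m.erase j, t i else 0 := by
    intro m
    split_ifs with hj
    · rw [← Finset.mul_prod_erase m _ hj, ← Finset.mul_prod_erase m t hj]
      rw [Finset.prod_congr rfl (g := t) (s₁ := m.erase j)]
      · simp; ring
      · intro i hi; rw [update_of_ne (ne_of_mem_erase hi)]
    · rw [add_zero, Finset.prod_congr rfl (g := t)]
      intro i hi; rw [update_of_ne]; rintro rfl; exact hj hi
  unfold polyEval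
  rw [Finset.sum_congr rfl (fun m _ => h1 m), Finset.sum_add_distrib]
  congr 1
  rw [← Finset.sum_filter, ← Finset.sum_filter_add_sum_filter_not univ (fun m => j ∈ m)
    (fun m => (if j ∈ m then 0 else c (insert j m)) * ∏ i ∈ m, t i)]
  rw [Finset.sum_eq_zero (s := univ.filter fun m => j ∈ m)
    (f := fun m => (if j ∈ m then 0 else c (insert j m)) * ∏ i ∈ m, t i), zero_add]
  · refine Finset.sum_nbij' (fun m => m.erase j) (fun m => insert j m) ?_ ?_ ?_ ?_ ?_
    · intro m _; simp
    · intro m _; simp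
    · intro m hm; simp only [mem_filter, mem_univ, true_and] at hm; exact insert_erase hm
    · intro m hm; simp only [mem_filter, mem_univ, true_and] at hm; exact erase_insert hm
    · intro m hm; simp only [mem_filter, mem_univ, true_and] at hm
      simp [insert_erase hm]
  · intro m hm; simp only [mem_filter, mem_univ, true_and] at hm; simp [hm]

/-- A square-free polynomial with a maximal monomial `π` is often non-zero. -/
theorem card_cube_le [Fintype F] [Field F] (s : Finset α) (b : α → F) (π : Finset α) (hπ : π ⊆ s) :
    ∀ c : Finset α → F, c π ≠ 0 → (∀ m, π ⊂ m → c m = 0) →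
      (cube s b).card ≤ 2 ^ π.card * ((cube s b).filter fun t => polyEval c t ≠ 0).card := by
  induction π using Finset.induction_on with
  | empty =>
    intro c h0 hm
    rw [Finset.filter_true_of_mem]
    · simp
    intro t _
    rw [polyEval, Finset.sum_eq_single ∅]
    · simpa using h0
    · intro m _ hne
      rw [hm m (Finset.empty_ssubset.2 (nonempty_iff_ne_empty.2 hne)), zero_mul]
    · simp
  | insert j π hj ih =>
    intro c h0 hm
    rw [insert_subset_iff] at hπ
    set c' : Finset α → F := fun m => if j ∈ m then 0 else c (insert j m) with hc'
    have h1 := ih hπ.2 c' (by simpa [hc', hj] using h0) (by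
      intro m hlt
      by_cases hjm : j ∈ m
      · simp [hc', hjm]
      · simp only [hc', hjm, if_false]
        apply hm
        rw [Finset.ssubset_iff_subset_ne] at hlt ⊢
        refine ⟨insert_subset_insert _ hlt.1, fun h => hlt.2 ?_⟩
        rw [← erase_insert hj, h, erase_insert hjm])
    refine h1.trans ?_
    rw [card_insert_of_notMem hj, pow_succ, mul_assoc]
    refine Nat.mul_le_mul_left _ ?_
    set A := (cube s b).filter fun t => polyEval c t ≠ 0 with hA
    have hsub : ((cube s b).filter fun t => polyEval c' t ≠ 0) ⊆
        A ∪ A.image (fun t => update t j (t j - 1)) := by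
      intro t ht
      rw [mem_filter] at ht
      rw [mem_union]
      by_cases hq : polyEval c t = 0
      · right
        rw [mem_image]
        refine ⟨update t j (t j + 1), ?_, by simp⟩
        rw [hA, mem_filter, polyEval_update, hq, zero_add]
        refine ⟨mem_cube.2 fun i hi => ?_, ht.2⟩
        rw [update_of_ne, mem_cube.1 ht.1 i hi]
        rintro rfl; exact hi hπ.1
      · left; rw [hA, mem_filter]; exact ⟨ht.1, hq⟩
    calc _ ≤ _ := card_le_card hsub
      _ ≤ A.card + (A.image _).card := card_union_le _ _
      _ ≤ A.card + A.card := Nat.add_le_add_left card_image_le _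
      _ = 2 * A.card := (two_mul _).symm

end Cube

section Equidistribution

variable {ι : Type} [Fintype ι] [DecidableEq ι] {V : ι → Type} [∀ i, AddCommGroup (V i)]
  [∀ i, Fintype (V i)] {p : ℕ} [Fact p.Prime]

theorem toCircle_eq_one_iff {q : ℕ} [NeZero q] (a : ZMod q) : ZMod.toCircle a = 1 ↔ a = 0 := by
  rw [← AddChar.map_zero_eq_one (ZMod.toCircle (N := q)), ZMod.injective_toCircle.eq_iff]

theorem coe_map_sum {α B : Type} [AddCommGroup B] (χ : AddChar B Circle) (s : Finset α)
    (f : α → B) : ((χ (∑ j ∈ s, f j) : Circle) : ℂ) = ∏ j ∈ s, (χ (f j) : ℂ) := by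
  induction s using Finset.induction_on with
  | empty => simp
  | insert j s hj ih =>
    rw [sum_insert hj, prod_insert hj, AddChar.map_add_eq_mul, Circle.coe_mul, ih]

theorem sum_toCircle_mul {q : ℕ} [NeZero q] (a : ZMod q) :
    ∑ c : ZMod q, ((ZMod.toCircle (c * a) : Circle) : ℂ) = if a = 0 then (q : ℂ) else 0 := by
  let ψ : AddChar (ZMod q) ℂ :=
    Circle.coeHom.compAddChar ((ZMod.toCircle (N := q)).compAddMonoidHom (AddMonoidHom.mulRight a))
  have h := AddChar.sum_eq_ite ψ
  have h2 : ψ = 0 ↔ a = 0 := by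
    rw [AddChar.eq_zero_iff]
    constructor
    · intro h
      have h1 : ((ZMod.toCircle ((1 : ZMod q) * a) : Circle) : ℂ) = 1 := h 1
      rw [one_mul, ← Circle.coe_one, Circle.coe_inj] at h1
      exact (toCircle_eq_one_iff a).1 h1
    · rintro rfl x
      change ((ZMod.toCircle (x * (0 : ZMod q)) : Circle) : ℂ) = 1
      simp
  rw [if_congr h2 rfl rfl, ZMod.card] at h
  exact h

theorem sum_cube_toCircle {α : Type} [Fintype α] (s : Finset α) (a : α → ZMod p) :
    ∑ c ∈ cube s (0 : α → ZMod p), ((ZMod.toCircle (∑ j ∈ s, c j * a j) : Circle) : ℂ) =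
      if ∀ j ∈ s, a j = 0 then (p : ℂ) ^ s.card else 0 := by
  have h := Finset.prod_univ_sum (fun j : α => if j ∈ s then (univ : Finset (ZMod p)) else {0})
    (fun j c => ((ZMod.toCircle (c * a j) : Circle) : ℂ))
  have hl : ∏ j, ∑ c ∈ (if j ∈ s then (univ : Finset (ZMod p)) else {0}),
      ((ZMod.toCircle (c * a j) : Circle) : ℂ) =
        if ∀ j ∈ s, a j = 0 then (p : ℂ) ^ s.card else 0 := by
    rw [← Finset.prod_subset (subset_univ s)]
    · rw [Finset.prod_congr rfl (g := fun j => if a j = 0 then (p : ℂ) else 0)]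
      · rw [Finset.prod_ite_zero, prod_const]; congr!
      · intro j hj; rw [if_pos hj, sum_toCircle_mul]
    · intro j _ hj; simp [hj]
  rw [← hl, h]
  refine Finset.sum_congr rfl fun c hc => ?_
  rw [coe_map_sum]
  refine Finset.prod_subset (subset_univ s) fun j _ hj => ?_
  rw [mem_cube.1 hc j hj]; simp

/-- The number of points of a level set, if the combinations of `h` have small bias. -/
theorem equidistribution {α : Type} [Fintype α] (s : Finset α) (h : α → (∀ i, V i) → ZMod p)
    {κ : ℝ} (hκ : 0 ≤ κ)
    (hs : ∀ c : α → ZMod p, (∃ j ∈ s, c j ≠ 0) →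
      ‖expSum (ZMod.toCircle (N := p)) (∑ j ∈ s, c j • h j)‖ ≤ κ * size V) (t : α → ZMod p) :
    |count (fun x => ∀ j ∈ s, h j x = t j) - size V / (p : ℝ) ^ s.card| ≤ κ * size V := by
  have hp : (0 : ℝ) < (p : ℝ) ^ s.card := by
    have : 0 < p := (Fact.out : p.Prime).pos
    positivity
  have e1 : ((p : ℂ) ^ s.card) * (count (fun x => ∀ j ∈ s, h j x = t j) : ℂ) =
      ∑ c ∈ cube s (0 : α → ZMod p), ((ZMod.toCircle (- ∑ j ∈ s, c j * t j) : Circle) : ℂ) *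
        expSum (ZMod.toCircle (N := p)) (∑ j ∈ s, c j • h j) := by
    have e2 : ∀ x, (if ∀ j ∈ s, h j x = t j then (p : ℂ) ^ s.card else 0) =
        ∑ c ∈ cube s (0 : α → ZMod p), ((ZMod.toCircle (- ∑ j ∈ s, c j * t j) : Circle) : ℂ) *
          ((ZMod.toCircle ((∑ j ∈ s, c j • h j) x) : Circle) : ℂ) := by
      intro x
      have := sum_cube_toCircle s (fun j => h j x - t j)
      simp only [sub_eq_zero] at this
      rw [← this]
      refine Finset.sum_congr rfl fun c _ => ?_
      rw [← Circle.coe_mul, ← AddChar.map_add_eq_mul]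
      congr 2
      simp only [Finset.sum_apply, Pi.smul_apply, smul_eq_mul, mul_sub, Finset.sum_sub_distrib]
      ring
    simp only [expSum, Finset.mul_sum]
    rw [Finset.sum_comm, ← Finset.sum_congr rfl (fun x _ => e2 x), count_eq, Finset.sum_ite]
    simp [mul_comm]
  have h0 : (0 : α → ZMod p) ∈ cube s (0 : α → ZMod p) := mem_cube.2 fun _ _ => rfl
  rw [← Finset.add_sum_erase _ _ h0] at e1
  have e3 : ((ZMod.toCircle (- ∑ j ∈ s, (0 : α → ZMod p) j * t j) : Circle) : ℂ) *
        expSum (ZMod.toCircle (N := p)) (∑ j ∈ s, (0 : α → ZMod p) j • h j) = (size V : ℂ) := by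
    simp [expSum, size]
  rw [e3] at e1
  have e4 : ‖((p : ℂ) ^ s.card) * (count (fun x => ∀ j ∈ s, h j x = t j) : ℂ) - (size V : ℂ)‖ ≤
      (p : ℝ) ^ s.card * (κ * size V) := by
    rw [e1, add_sub_cancel_left]
    refine (norm_sum_le _ _).trans ?_
    calc _ ≤ ∑ c ∈ (cube s (0 : α → ZMod p)).erase 0, κ * size V := by
          refine Finset.sum_le_sum fun c hc => ?_
          rw [norm_mul, Circle.norm_coe, one_mul]
          refine hs c ?_
          by_contra! hcon
          rw [mem_erase] at hc
          refine hc.1 (funext fun j => ?_)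
          by_cases hj : j ∈ s
          · exact hcon j hj
          · exact mem_cube.1 hc.2 j hj
      _ ≤ _ := by
          rw [sum_const, nsmul_eq_mul]
          refine mul_le_mul_of_nonneg_right ?_ (mul_nonneg hκ size_pos.le)
          have : ((cube s (0 : α → ZMod p)).erase 0).card ≤ p ^ s.card := by
            refine (card_le_card (erase_subset _ _)).trans ?_
            rw [card_cube, ZMod.card]
          exact_mod_cast this
  have e5 : ((p : ℂ) ^ s.card) * (count (fun x => ∀ j ∈ s, h j x = t j) : ℂ) - (size V : ℂ) =
      (((p : ℝ) ^ s.card *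
        (count (fun x => ∀ j ∈ s, h j x = t j) - size V / (p : ℝ) ^ s.card) : ℝ) : ℂ) := by
    rw [mul_sub, mul_div_cancel₀ _ hp.ne']
    push_cast
    rfl
  rw [e5, Complex.norm_real, norm_mul, Real.norm_of_nonneg hp.le] at e4
  exact le_of_mul_le_mul_left e4 hp

end Equidistribution

section Families

variable {ι : Type} [Fintype ι] [DecidableEq ι] {V : ι → Type} [∀ i, AddCommGroup (V i)]
  [∀ i, Fintype (V i)] {p : ℕ} [Fact p.Prime]

variable (V p) in
/-- A function to `ZMod p` together with the set of coordinates on which it is a form. -/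
abbrev Atom : Type := Finset ι × ((∀ i, V i) → ZMod p)

/-- Every atom is a form on a non-empty set of coordinates inside `K`. -/
def Valid (K : Finset ι) (𝓖 : Finset (Atom V p)) : Prop :=
  ∀ g ∈ 𝓖, g.1.Nonempty ∧ g.1 ⊆ K ∧ IsForm g.1 g.2

/-- Non-trivial combinations of atoms on the same set of coordinates have bias less than `κ`. -/
def Regular (κ : ℝ) (𝓖 : Finset (Atom V p)) : Prop :=
  ∀ (I : Finset ι) (c : Atom V p → ZMod p), (∃ g ∈ 𝓖, g.1 = I ∧ c g ≠ 0) →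
    ‖expSum (ZMod.toCircle (N := p)) (∑ g ∈ 𝓖 with g.1 = I, c g • g.2)‖ < κ * size V

/-- `f` is a polynomial in the atoms of `𝓖`, multilinear on `K`. -/
inductive Gen (𝓖 : Finset (Atom V p)) : Finset ι → ((∀ i, V i) → ZMod p) → Prop
  | of (g : Atom V p) (hg : g ∈ 𝓖) : Gen 𝓖 g.1 g.2
  | zero (K : Finset ι) : Gen 𝓖 K 0
  | add {K : Finset ι} {f g : (∀ i, V i) → ZMod p} : Gen 𝓖 K f → Gen 𝓖 K g → Gen 𝓖 K (f + g)
  | smul {K : Finset ι} {f : (∀ i, V i) → ZMod p} (c : ZMod p) : Gen 𝓖 K f → Gen 𝓖 K (c • f)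
  | mul {K L : Finset ι} {f g : (∀ i, V i) → ZMod p} : Disjoint K L → Gen 𝓖 K f → Gen 𝓖 L g →
      Gen 𝓖 (K ∪ L) (f * g)

theorem Gen.trans {𝓖 𝓝 : Finset (Atom V p)} (h : ∀ g ∈ 𝓝, Gen 𝓖 g.1 g.2) {K : Finset ι}
    {f : (∀ i, V i) → ZMod p} (hf : Gen 𝓝 K f) : Gen 𝓖 K f := by
  induction hf with
  | of g hg => exact h g hg
  | zero K => exact Gen.zero K
  | add _ _ h1 h2 => exact h1.add h2
  | smul c _ h1 => exact h1.smul c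
  | mul hd _ _ h1 h2 => exact h1.mul hd h2

theorem Gen.mono {𝓖 𝓝 : Finset (Atom V p)} (h : 𝓝 ⊆ 𝓖) {K : Finset ι}
    {f : (∀ i, V i) → ZMod p} (hf : Gen 𝓝 K f) : Gen 𝓖 K f :=
  hf.trans fun g hg => Gen.of g (h hg)

theorem Gen.sum {𝓖 : Finset (Atom V p)} {K : Finset ι} {α : Type*} (s : Finset α)
    {f : α → (∀ i, V i) → ZMod p} (hf : ∀ l ∈ s, Gen 𝓖 K (f l)) : Gen 𝓖 K (∑ l ∈ s, f l) :=
  Finset.sum_induction f (Gen 𝓖 K) (fun _ _ => Gen.add) (Gen.zero K) hf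

/-- A generated function is determined by the values of the atoms. -/
theorem Gen.congr {𝓖 : Finset (Atom V p)} {K : Finset ι} {f : (∀ i, V i) → ZMod p}
    (hf : Gen 𝓖 K f) {x y : ∀ i, V i} (h : ∀ g ∈ 𝓖, g.2 x = g.2 y) : f x = f y := by
  induction hf with
  | of g hg => exact h g hg
  | zero K => rfl
  | add _ _ h1 h2 => simp [h1, h2]
  | smul c _ h1 => simp [h1]
  | mul hd _ _ h1 h2 => simp [h1, h2]

/-- `m` is a partition of `K` into atoms of `𝓖`. -/
def IsMonomial (𝓖 : Finset (Atom V p)) (K : Finset ι) (m : Finset (Atom V p)) : Prop :=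
  m ⊆ 𝓖 ∧ (m : Set (Atom V p)).PairwiseDisjoint Prod.fst ∧ m.biUnion Prod.fst = K

/-- The product of the atoms of `m`. -/
noncomputable def monomialFun (m : Finset (Atom V p)) : (∀ i, V i) → ZMod p := ∏ g ∈ m, g.2

variable (V p) in
theorem isForm_one : IsForm (∅ : Finset ι) (1 : (∀ i, V i) → ZMod p) := by
  constructor <;> simp

theorem IsForm.smul {R : Type} [CommRing R] {J : Finset ι} {f : (∀ i, V i) → R} (c : R)
    (hf : IsForm J f) :
    IsForm J (c • f) :=
  hf.hom (AddMonoidHom.mulLeft c)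

theorem isForm_monomialFun {K : Finset ι} {𝓖 : Finset (Atom V p)} (hV : Valid K 𝓖)
    {m : Finset (Atom V p)} (hm : m ⊆ 𝓖) (hd : (m : Set (Atom V p)).PairwiseDisjoint Prod.fst) :
    IsForm (m.biUnion Prod.fst) (monomialFun m) := by
  induction m using Finset.induction_on with
  | empty => simpa [monomialFun] using isForm_one V p
  | insert g m hg ih =>
    rw [insert_subset_iff] at hm
    rw [coe_insert] at hd
    rw [monomialFun, prod_insert hg, biUnion_insert]
    refine IsForm.mul ?_ (hV g hm.1).2.2 (ih hm.2 (hd.subset (Set.subset_insert _ _)))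
    rw [Finset.disjoint_biUnion_right]
    intro g' hg'
    exact hd (Set.mem_insert _ _) (Set.mem_insert_of_mem _ hg') (by rintro rfl; exact hg hg')

theorem Gen.mem_span {K : Finset ι} {𝓖 : Finset (Atom V p)} (hV : Valid K 𝓖) {L : Finset ι}
    {f : (∀ i, V i) → ZMod p} (hf : Gen 𝓖 L f) :
    f ∈ Submodule.span (ZMod p) (monomialFun '' {m | IsMonomial 𝓖 L m}) := by
  induction hf with
  | of g hg =>
    refine Submodule.subset_span ⟨{g}, ⟨by simpa using hg, by simp, by simp⟩, ?_⟩
    simp [monomialFun]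
  | zero K => exact Submodule.zero_mem _
  | add _ _ h1 h2 => exact Submodule.add_mem _ h1 h2
  | smul c _ h1 => exact Submodule.smul_mem _ c h1
  | @mul L M f g hd _ _ h1 h2 =>
    have h3 := Submodule.mul_mem_mul h1 h2
    rw [Submodule.span_mul_span] at h3
    refine Submodule.span_mono ?_ h3
    rintro _ ⟨_, ⟨m, hm, rfl⟩, _, ⟨n, hn, rfl⟩, rfl⟩
    have hcross : ∀ a ∈ m, ∀ b ∈ n, Disjoint a.1 b.1 := fun a ha b hb =>
      Finset.disjoint_of_subset_left (by rw [← hm.2.2]; exact subset_biUnion_of_mem Prod.fst ha)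
        (Finset.disjoint_of_subset_right
          (by rw [← hn.2.2]; exact subset_biUnion_of_mem Prod.fst hb) hd)
    refine ⟨m ∪ n, ⟨union_subset hm.1 hn.1, ?_, ?_⟩, ?_⟩
    · rw [coe_union]
      refine hm.2.1.union hn.2.1 fun a ha b hb _ => hcross a ha b hb
    · rw [union_biUnion, hm.2.2, hn.2.2]
    · refine prod_union (Finset.disjoint_left.2 fun a ha hb => ?_)
      exact (hV a (hm.1 ha)).1.ne_empty (disjoint_self.1 (hcross a ha a hb))

theorem Gen.exists_coeff {K : Finset ι} {𝓖 : Finset (Atom V p)} (hV : Valid K 𝓖) {L : Finset ι}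
    {f : (∀ i, V i) → ZMod p} (hf : Gen 𝓖 L f) :
    ∃ c : Finset (Atom V p) → ZMod p, (∀ m, c m ≠ 0 → IsMonomial 𝓖 L m) ∧
      f = ∑ m, c m • monomialFun m := by
  have h := hf.mem_span hV
  have h' : {m | IsMonomial 𝓖 L m} = ((univ.filter fun m => IsMonomial 𝓖 L m :
      Finset (Finset (Atom V p))) : Set (Finset (Atom V p))) := by
    ext m; simp
  rw [h'] at h
  obtain ⟨c, hc⟩ := (Submodule.mem_span_image_finset_iff_exists_fun' _).1 h
  refine ⟨fun m => if IsMonomial 𝓖 L m then c m else 0, fun m hm => ?_, ?_⟩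
  · by_contra hcon; simp [hcon] at hm
  · rw [← hc, Finset.sum_filter]
    refine Finset.sum_congr rfl fun m _ => ?_
    by_cases hm : IsMonomial 𝓖 L m <;> simp [hm]

theorem Regular.mono {κ κ' : ℝ} (h : κ ≤ κ') {𝓖 : Finset (Atom V p)} (hR : Regular κ 𝓖) :
    Regular κ' 𝓖 := fun I c hc =>
  (hR I c hc).trans_le (mul_le_mul_of_nonneg_right h size_pos.le)

theorem Regular.norm_expSum_le {κ : ℝ} {K : Finset ι} {𝓖 : Finset (Atom V p)}
    (hV : Valid K 𝓖) (hR : Regular κ 𝓖) (c : Atom V p → ZMod p) (hc : ∃ g ∈ 𝓖, c g ≠ 0) :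
    ‖expSum (ZMod.toCircle (N := p)) (∑ g ∈ 𝓖, c g • g.2)‖ ≤ κ * size V := by
  obtain ⟨g0, hg0, hmax⟩ := Finset.exists_max_image (𝓖.filter fun g => c g ≠ 0)
    (fun g => g.1.card) (by obtain ⟨g, hg, h⟩ := hc; exact ⟨g, mem_filter.2 ⟨hg, h⟩⟩)
  rw [mem_filter] at hg0
  have h1 : ∑ g ∈ 𝓖, c g • g.2 = (∑ g ∈ 𝓖 with g.1 = g0.1, c g • g.2) +
      ∑ g ∈ 𝓖 with (g.1 ≠ g0.1 ∧ c g ≠ 0), c g • g.2 := by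
    rw [← Finset.sum_filter_add_sum_filter_not 𝓖 (fun g => g.1 = g0.1)]
    congr 1
    rw [← Finset.filter_filter]
    symm
    refine Finset.sum_subset (filter_subset _ _) fun g hg hg' => ?_
    have : c g = 0 := by
      by_contra hne
      exact hg' (mem_filter.2 ⟨hg, hne⟩)
    rw [this, zero_smul]
  rw [h1]
  refine (norm_expSum_add_sum_le _ (J := g0.1) ?_ _ (fun g => g.1) (fun g => c g • g.2) ?_ ?_).trans
    (hR g0.1 c ⟨g0, hg0.1, rfl, hg0.2⟩).le
  · refine IsForm.sum _ fun g hg => ?_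
    rw [mem_filter] at hg
    rw [← hg.2]
    exact (hV g hg.1).2.2.smul _
  · intro g hg
    exact (hV g (mem_filter.1 hg).1).2.2.smul _
  · intro g hg hsub
    rw [mem_filter] at hg
    exact hg.2.1 (Finset.eq_of_subset_of_card_le hsub
      (hmax g (mem_filter.2 ⟨hg.1, hg.2.2⟩))).symm

theorem Regular.equidistribution {κ : ℝ} (hκ : 0 ≤ κ) {K : Finset ι} {𝓖 : Finset (Atom V p)}
    (hV : Valid K 𝓖) (hR : Regular κ 𝓖) (t : Atom V p → ZMod p) :
    |count (fun x => ∀ g ∈ 𝓖, g.2 x = t g) - size V / (p : ℝ) ^ 𝓖.card| ≤ κ * size V :=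
  BiasInverse.equidistribution 𝓖 Prod.snd hκ (hR.norm_expSum_le hV) t

/-- `f` lies in the ideal generated by `𝓖`, among the forms on `J`. -/
def InIdeal (J : Finset ι) (𝓖 : Finset (Atom V p)) (f : (∀ i, V i) → ZMod p) : Prop :=
  ∃ b : Atom V p → (∀ i, V i) → ZMod p, (∀ g ∈ 𝓖, IsForm (J \ g.1) (b g)) ∧
    f = ∑ g ∈ 𝓖, g.2 * b g

/-- `f` has partition rank at most `r` as a form on `J`. -/
def PRank (J : Finset ι) (r : ℕ) (f : (∀ i, V i) → ZMod p) : Prop :=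
  ∃ 𝓐 : Finset (Atom V p), 𝓐.card ≤ r ∧ Valid J 𝓐 ∧ (∀ g ∈ 𝓐, g.1 ≠ J) ∧ InIdeal J 𝓐 f

/-- A function of bounded partition rank is generated by boundedly many smaller atoms. -/
theorem PRank.exists_gen {J : Finset ι} {r : ℕ} {f : (∀ i, V i) → ZMod p} (h : PRank J r f) :
    ∃ 𝓐 : Finset (Atom V p), 𝓐.card ≤ 2 * r ∧ Valid J 𝓐 ∧ (∀ g ∈ 𝓐, g.1 ≠ J) ∧ Gen 𝓐 J f := by
  obtain ⟨𝓐, hcard, hV, hne, b, hb, rfl⟩ := h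
  refine ⟨𝓐 ∪ 𝓐.image fun g => (J \ g.1, b g), ?_, ?_, ?_, ?_⟩
  · refine (card_union_le _ _).trans ?_
    have := card_image_le (s := 𝓐) (f := fun g => ((J \ g.1, b g) : Atom V p))
    omega
  · intro g hg
    rcases mem_union.1 hg with hg | hg
    · exact hV g hg
    · obtain ⟨g, hg', rfl⟩ := mem_image.1 hg
      refine ⟨?_, sdiff_subset, hb g hg'⟩
      rw [Finset.sdiff_nonempty]
      exact fun hsub => hne g hg' ((hV g hg').2.1.antisymm hsub)
  · intro g hg
    rcases mem_union.1 hg with hg | hg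
    · exact hne g hg
    · obtain ⟨g, hg', rfl⟩ := mem_image.1 hg
      intro h
      obtain ⟨i, hi⟩ := (hV g hg').1
      have : i ∈ J \ g.1 := (congrArg (i ∈ ·) h).mpr ((hV g hg').2.1 hi)
      exact (mem_sdiff.1 this).2 hi
  · refine Gen.sum _ fun g hg => ?_
    have h1 : J = g.1 ∪ J \ g.1 := (union_sdiff_of_subset (hV g hg).2.1).symm
    rw [h1]
    refine Gen.mul disjoint_sdiff (Gen.of g (mem_union_left _ hg)) ?_
    rw [← h1]
    exact Gen.of ((J \ g.1, b g) : Atom V p) (mem_union_right _ (mem_image_of_mem _ hg))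

end Families

/-- Biased forms on `n` coordinates over `ZMod p` have bounded partition rank. -/
def Good (p : ℕ) [Fact p.Prime] (n : ℕ) : Prop :=
  ∀ ε : ℝ, 0 < ε → ∃ r : ℕ, ∀ (ι : Type) [Fintype ι] [DecidableEq ι] (V : ι → Type)
    [∀ i, AddCommGroup (V i)] [∀ i, Fintype (V i)] (J : Finset ι) (f : (∀ i, V i) → ZMod p),
    J.card = n → IsForm J f → ε * size V ≤ ‖expSum (ZMod.toCircle (N := p)) f‖ → PRank J r f

theorem exists_pos_le {α : Type*} (s : Finset α) (f : α → ℝ) (hf : ∀ a ∈ s, 0 < f a) :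
    ∃ δ : ℝ, 0 < δ ∧ ∀ a ∈ s, δ ≤ f a := by
  induction s using Finset.induction_on with
  | empty => exact ⟨1, one_pos, by simp⟩
  | insert a s ha ih =>
    obtain ⟨δ, hδ, h⟩ := ih fun b hb => hf b (mem_insert_of_mem hb)
    refine ⟨min δ (f a), lt_min hδ (hf a (mem_insert_self _ _)), fun b hb => ?_⟩
    rcases mem_insert.1 hb with rfl | hb
    · exact min_le_right _ _
    · exact (min_le_left _ _).trans (h b hb)

section Step

variable {ι : Type} [Fintype ι] [DecidableEq ι] {V : ι → Type} [∀ i, AddCommGroup (V i)]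
  [∀ i, Fintype (V i)] {p : ℕ} [Fact p.Prime]

theorem Valid.union {K : Finset ι} {𝓗 𝓝 : Finset (Atom V p)} (h1 : Valid K 𝓗) (h2 : Valid K 𝓝) :
    Valid K (𝓗 ∪ 𝓝) := fun g hg => (mem_union.1 hg).elim (h1 g) (h2 g)

theorem Valid.mono {K L : Finset ι} (h : K ⊆ L) {𝓗 : Finset (Atom V p)} (h1 : Valid K 𝓗) :
    Valid L 𝓗 := fun g hg => ⟨(h1 g hg).1, (h1 g hg).2.1.trans h, (h1 g hg).2.2⟩

/-- If the combined family is not regular, one of the new atoms can be replaced. -/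
theorem exists_replacement {κ : ℝ} {K : Finset ι} {𝓗 𝓝 : Finset (Atom V p)} (hH : Valid K 𝓗)
    (hN : Valid K 𝓝) (hR : Regular κ 𝓗) (hnot : ¬ Regular κ (𝓗 ∪ 𝓝)) (R : ℕ → ℕ)
    (hRank : ∀ (I : Finset ι) (θ : (∀ i, V i) → ZMod p), I.Nonempty → I ⊆ K → IsForm I θ →
      κ * size V ≤ ‖expSum (ZMod.toCircle (N := p)) θ‖ → PRank I (R I.card) θ) :
    ∃ g₁ ∈ 𝓝, ∃ 𝓐 : Finset (Atom V p), 𝓐.card ≤ 2 * R g₁.1.card ∧ Valid g₁.1 𝓐 ∧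
      (∀ g ∈ 𝓐, g.1 ≠ g₁.1) ∧ Gen (𝓗 ∪ (𝓝.erase g₁ ∪ 𝓐)) g₁.1 g₁.2 := by
  unfold Regular at hnot
  push Not at hnot
  obtain ⟨I, c, ⟨g₀, hg₀, hI, hc₀⟩, hbias⟩ := hnot
  have hV := hH.union hN
  have hex : ∃ g₁ ∈ 𝓝, g₁ ∉ 𝓗 ∧ g₁.1 = I ∧ c g₁ ≠ 0 := by
    by_contra! hcon
    have hsum : ∑ g ∈ 𝓗 ∪ 𝓝 with g.1 = I, c g • g.2 = ∑ g ∈ 𝓗 with g.1 = I, c g • g.2 := by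
      symm
      refine Finset.sum_subset (filter_subset_filter _ subset_union_left) fun g hg hg' => ?_
      rw [mem_filter] at hg hg'
      have hgH : g ∉ 𝓗 := fun h => hg' ⟨h, hg.2⟩
      rw [hcon g ((mem_union.1 hg.1).resolve_left hgH) hgH hg.2, zero_smul]
    rw [hsum] at hbias
    have hg₀H : g₀ ∈ 𝓗 := by
      by_contra h
      exact hc₀ (hcon g₀ ((mem_union.1 hg₀).resolve_left h) h hI)
    exact absurd (hR I c ⟨g₀, hg₀H, hI, hc₀⟩) (not_lt.2 hbias)
  obtain ⟨g₁, hg₁, hg₁H, rfl, hc₁⟩ := hex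
  have hθ : IsForm g₁.1 (∑ g ∈ 𝓗 ∪ 𝓝 with g.1 = g₁.1, c g • g.2) := by
    refine IsForm.sum _ fun g hg => ?_
    rw [mem_filter] at hg
    rw [← hg.2]
    exact (hV g hg.1).2.2.smul _
  obtain ⟨𝓐, hcard, hA, hne, hgen⟩ :=
    (hRank g₁.1 _ (hN g₁ hg₁).1 (hN g₁ hg₁).2.1 hθ hbias).exists_gen
  refine ⟨g₁, hg₁, 𝓐, hcard, hA, hne, ?_⟩
  have hmem : g₁ ∈ (𝓗 ∪ 𝓝).filter fun g => g.1 = g₁.1 :=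
    mem_filter.2 ⟨mem_union_right _ hg₁, rfl⟩
  have heq : g₁.2 = (c g₁)⁻¹ • ((∑ g ∈ 𝓗 ∪ 𝓝 with g.1 = g₁.1, c g • g.2) +
      (-1 : ZMod p) • ∑ g ∈ ((𝓗 ∪ 𝓝).filter fun g => g.1 = g₁.1).erase g₁, c g • g.2) := by
    rw [← Finset.add_sum_erase _ _ hmem, neg_smul, one_smul, add_neg_cancel_right, smul_smul,
      inv_mul_cancel₀ hc₁, one_smul]
  rw [heq]
  refine Gen.smul _ (Gen.add (hgen.mono ?_) (Gen.smul _ (Gen.sum _ fun g hg => Gen.smul _ ?_)))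
  · exact subset_union_right.trans subset_union_right
  · rw [mem_erase, mem_filter] at hg
    rw [← hg.2.2]
    refine Gen.of g ?_
    rcases mem_union.1 hg.2.1 with h | h
    · exact mem_union_left _ h
    · exact mem_union_right _ (mem_union_left _ (mem_erase.2 ⟨hg.1, h⟩))

theorem Valid.card_le {d : ℕ} {K : Finset ι} (hK : K.card ≤ d) {𝓝 : Finset (Atom V p)}
    (hN : Valid K 𝓝) {prof : Fin d → ℕ}
    (hprof : ∀ l : Fin d, (𝓝.filter fun g => g.1.card = (l : ℕ) + 1).card ≤ prof l) :
    𝓝.card ≤ ∑ l, prof l := by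
  have hsub : 𝓝 ⊆ univ.biUnion fun l : Fin d => 𝓝.filter fun g => g.1.card = (l : ℕ) + 1 := by
    intro g hg
    have h1 := (hN g hg).1.card_pos
    have h2 := card_le_card (hN g hg).2.1
    rw [mem_biUnion]
    refine ⟨⟨g.1.card - 1, by omega⟩, mem_univ _, mem_filter.2 ⟨hg, ?_⟩⟩
    simp only
    omega
  exact (card_le_card hsub).trans (card_biUnion_le.trans (Finset.sum_le_sum fun l _ => hprof l))

end Step

/-- The conclusion of relative regularization, with explicit bounds. -/
def Regularizable (p : ℕ) [Fact p.Prime] (d : ℕ) (κ : ℕ → ℝ) (m : ℕ) (prof : Fin d → ℕ) (N : ℕ)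
    (κ₀ : ℝ) : Prop :=
  ∀ (ι : Type) [Fintype ι] [DecidableEq ι] (V : ι → Type) [∀ i, AddCommGroup (V i)]
    [∀ i, Fintype (V i)] (K : Finset ι) (𝓗 𝓝 : Finset (Atom V p)), K.card ≤ d → Valid K 𝓗 →
    Valid K 𝓝 → 𝓗.card ≤ m → Regular κ₀ 𝓗 →
    (∀ l : Fin d, (𝓝.filter fun g => g.1.card = (l : ℕ) + 1).card ≤ prof l) →
    ∃ 𝓖 : Finset (Atom V p), 𝓗 ⊆ 𝓖 ∧ Valid K 𝓖 ∧ 𝓖.card ≤ N ∧ Regular (κ 𝓖.card) 𝓖 ∧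
      ∀ g ∈ 𝓝, Gen 𝓖 g.1 g.2

/-- A sufficiently regular family and boundedly many further atoms can be refined to a regular
family which contains the original one. -/
theorem exists_regularizable {p : ℕ} [Fact p.Prime] (d : ℕ)
    (hGood : ∀ n, 1 ≤ n → n ≤ d → Good p n) (κ : ℕ → ℝ) (hκ : ∀ n, 0 < κ n) (m : ℕ)
    (prof : Fin d → ℕ) : ∃ N κ₀, 0 < κ₀ ∧ Regularizable p d κ m prof N κ₀ := by
  have wf : WellFounded (Pi.Lex (β := fun _ : Fin d => ℕ) (· > ·) (fun {_} => (· < ·))) :=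
    Pi.Lex.wellFounded _ fun _ => wellFounded_lt
  induction prof using wf.induction with
  | _ prof ih =>
  set n₀ := m + ∑ l, prof l with hn₀
  obtain ⟨κs, hκs, hκs_le⟩ := exists_pos_le (range (n₀ + 1)) κ fun n _ => hκ n
  have hR : ∀ n, ∃ r, 1 ≤ n → n ≤ d → ∀ (ι : Type) [Fintype ι] [DecidableEq ι] (V : ι → Type)
      [∀ i, AddCommGroup (V i)] [∀ i, Fintype (V i)] (J : Finset ι) (f : (∀ i, V i) → ZMod p),
      J.card = n → IsForm J f → κs * size V ≤ ‖expSum (ZMod.toCircle (N := p)) f‖ →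
        PRank J r f := by
    intro n
    by_cases h : 1 ≤ n ∧ n ≤ d
    · obtain ⟨r, hr⟩ := hGood n h.1 h.2 κs hκs
      exact ⟨r, fun _ _ => hr⟩
    · exact ⟨0, fun h1 h2 => absurd ⟨h1, h2⟩ h⟩
  choose R hR using hR
  let prof' : Fin d → Fin d → ℕ := fun l l' =>
    if l < l' then prof l' else if l' = l then prof l - 1 else prof l' + 2 * R (l + 1)
  have hnext : ∀ l : Fin d, ∃ N κ₀, 0 < κ₀ ∧
      (0 < prof l → Regularizable p d κ m (prof' l) N κ₀) := by
    intro l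
    by_cases hl : 0 < prof l
    · obtain ⟨N, κ₀, h0, h⟩ := ih (prof' l) ⟨l, fun j hj => by simp only [prof', if_pos hj], by
        simp only [prof', lt_irrefl, if_false, if_true]; omega⟩
      exact ⟨N, κ₀, h0, fun _ => h⟩
    · exact ⟨0, 1, one_pos, fun h => absurd h hl⟩
  choose N κ₀ hκ₀ hN using hnext
  obtain ⟨δ, hδ, hδ_le⟩ := exists_pos_le univ κ₀ fun l _ => hκ₀ l
  refine ⟨n₀ + ∑ l, N l, min κs δ, lt_min hκs hδ, ?_⟩
  intro ι _ _ V _ _ K 𝓗 𝓝 hK hH hNv hcard hReg hprof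
  have hNcard : (𝓗 ∪ 𝓝).card ≤ n₀ :=
    (card_union_le _ _).trans (Nat.add_le_add hcard (hNv.card_le hK hprof))
  by_cases hall : Regular κs (𝓗 ∪ 𝓝)
  · exact ⟨𝓗 ∪ 𝓝, subset_union_left, hH.union hNv, hNcard.trans (Nat.le_add_right _ _),
      hall.mono (hκs_le _ (mem_range.2 (by omega))), fun g hg => Gen.of g (mem_union_right _ hg)⟩
  obtain ⟨g₁, hg₁, 𝓐, hAcard, hA, hAne, hgen⟩ := exists_replacement hH hNv
    (hReg.mono (min_le_left _ _)) hall R fun I θ hI hIK hθ hb =>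
      hR I.card hI.card_pos ((card_le_card hIK).trans hK) ι V I θ rfl hθ hb
  have h1 := (hNv g₁ hg₁).1.card_pos
  have h2 := (card_le_card (hNv g₁ hg₁).2.1).trans hK
  obtain ⟨l, hl⟩ : ∃ l : Fin d, g₁.1.card = l + 1 :=
    ⟨⟨g₁.1.card - 1, by omega⟩, by simp only; omega⟩
  have hpos : 0 < prof l :=
    (card_pos.2 ⟨g₁, mem_filter.2 ⟨hg₁, hl⟩⟩).trans_le (hprof l)
  have hAlt : ∀ g ∈ 𝓐, g.1.card < g₁.1.card := fun g hg =>
    card_lt_card (Finset.ssubset_iff_subset_ne.2 ⟨(hA g hg).2.1, hAne g hg⟩)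
  obtain ⟨𝓖, hHG, hVG, hcG, hRG, hgG⟩ := hN l hpos ι V K 𝓗 (𝓝.erase g₁ ∪ 𝓐) hK hH
    (Valid.union (fun g hg => hNv g (mem_of_mem_erase hg)) (hA.mono (hNv g₁ hg₁).2.1)) hcard
    (hReg.mono ((min_le_right _ _).trans (hδ_le l (mem_univ _)))) (by
      intro l'
      rw [filter_union]
      refine (card_union_le _ _).trans ?_
      simp only [prof']
      have hA0 : g₁.1.card ≤ (l' : ℕ) + 1 →
            (𝓐.filter fun g => g.1.card = (l' : ℕ) + 1).card = 0 := by
        intro hle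
        rw [card_eq_zero, filter_eq_empty_iff]
        intro g hg
        have := hAlt g hg
        omega
      have hmono : ((𝓝.erase g₁).filter fun g => g.1.card = (l' : ℕ) + 1).card ≤ prof l' :=
        (card_le_card (filter_subset_filter _ (erase_subset _ _))).trans (hprof l')
      split_ifs with hlt heq
      · rw [hA0 (by have : (l : ℕ) < l' := hlt; omega)]
        exact hmono
      · subst heq
        rw [hA0 (by omega), filter_erase, card_erase_of_mem (mem_filter.2 ⟨hg₁, hl⟩)]
        exact Nat.sub_le_sub_right (hprof l') 1
      · refine Nat.add_le_add hmono ((card_le_card (filter_subset _ _)).trans ?_)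
        rw [← hl]; exact hAcard)
  refine ⟨𝓖, hHG, hVG, hcG.trans ?_, hRG, fun g hg => ?_⟩
  · exact (Finset.single_le_sum (f := N) (fun _ _ => Nat.zero_le _) (mem_univ l)).trans
      (Nat.le_add_left _ _)
  · by_cases hgg : g = g₁
    · subst hgg
      refine hgen.trans fun g' hg' => ?_
      rcases mem_union.1 hg' with h | h
      · exact Gen.of g' (hHG h)
      · exact hgG g' h
    · exact hgG g (mem_union_left _ (mem_erase.2 ⟨hgg, hg⟩))

section Selection

variable {Ω : Type} [Fintype Ω]

theorem exists_greedy {ξ : Type} (S : Finset ξ) (P : ξ → Ω → Prop) {η : ℝ} (hη : η ≤ 1) (s : ℕ) :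
    ∃ Y ⊆ S, Y.card ≤ s ∧
      ((∀ y ∈ S, ((univ.filter fun x => (∀ z ∈ Y, ¬ P z x) ∧ P y x).card : ℝ) ≤
          η * ((univ.filter fun x => ∀ z ∈ Y, ¬ P z x).card : ℝ)) ∨
        ((univ.filter fun x => ∀ z ∈ Y, ¬ P z x).card : ℝ) ≤ (1 - η) ^ s * Fintype.card Ω) := by
  induction s with
  | zero =>
    refine ⟨∅, empty_subset _, le_rfl, Or.inr ?_⟩
    rw [pow_zero, one_mul]
    exact_mod_cast card_le_univ _
  | succ s ih =>
    obtain ⟨Y, hYS, hY, h⟩ := ih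
    by_cases hgood : ∀ y ∈ S, ((univ.filter fun x => (∀ z ∈ Y, ¬ P z x) ∧ P y x).card : ℝ) ≤
          η * ((univ.filter fun x => ∀ z ∈ Y, ¬ P z x).card : ℝ)
    · exact ⟨Y, hYS, hY.trans (Nat.le_succ _), Or.inl hgood⟩
    have h := h.resolve_left hgood
    push Not at hgood
    obtain ⟨y, hy, hlt⟩ := hgood
    refine ⟨insert y Y, insert_subset hy hYS, (card_insert_le _ _).trans (Nat.succ_le_succ hY),
      Or.inr ?_⟩
    have hsplit := Finset.card_filter_add_card_filter_not
      (s := univ.filter fun x => ∀ z ∈ Y, ¬ P z x) (fun x => P y x)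
    rw [filter_filter, filter_filter] at hsplit
    have heq : (univ.filter fun x => ∀ z ∈ insert y Y, ¬ P z x) =
        univ.filter fun x => (∀ z ∈ Y, ¬ P z x) ∧ ¬ P y x := by
      ext x; simp [and_comm]
    rw [heq]
    have hsplit' : ((univ.filter fun x => (∀ z ∈ Y, ¬ P z x) ∧ P y x).card : ℝ) +
        ((univ.filter fun x => (∀ z ∈ Y, ¬ P z x) ∧ ¬ P y x).card : ℝ) =
        ((univ.filter fun x => ∀ z ∈ Y, ¬ P z x).card : ℝ) := by exact_mod_cast hsplit
    calc _ ≤ (1 - η) * ((univ.filter fun x => ∀ z ∈ Y, ¬ P z x).card : ℝ) := by linarith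
      _ ≤ (1 - η) * ((1 - η) ^ s * Fintype.card Ω) :=
        mul_le_mul_of_nonneg_left h (by linarith)
      _ = _ := by rw [pow_succ]; ring

theorem exists_fiber {T : Type} (Z : Finset Ω) (hZ : Z.Nonempty) (τ : Ω → T) (P : Ω → Prop)
    {η : ℝ} (h : ((Z.filter P).card : ℝ) ≤ η * Z.card) :
    ∃ x₀ ∈ Z, ((Z.filter fun x => τ x = τ x₀ ∧ P x).card : ℝ) ≤
      η * ((Z.filter fun x => τ x = τ x₀).card : ℝ) := by
  by_contra! hcon
  have h1 := Finset.card_eq_sum_card_fiberwise (f := τ) (s := Z.filter P) (t := Z.image τ)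
    fun x hx => mem_image_of_mem _ (mem_filter.1 hx).1
  have h2 := Finset.card_eq_sum_card_fiberwise (f := τ) (s := Z) (t := Z.image τ)
    fun x hx => mem_image_of_mem _ hx
  have h3 : η * (Z.card : ℝ) < ((Z.filter P).card : ℝ) := by
    rw [h1, h2]
    push_cast
    rw [Finset.mul_sum]
    refine Finset.sum_lt_sum_of_nonempty (hZ.image τ) fun t ht => ?_
    obtain ⟨x₀, hx₀, rfl⟩ := mem_image.1 ht
    refine (hcon x₀ hx₀).trans_le ?_
    rw [filter_filter]
    exact_mod_cast card_le_card fun x hx => by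
      simp only [mem_filter] at hx ⊢; tauto
  linarith

end Selection

section Ideal

variable {ι : Type} [Fintype ι] [DecidableEq ι] {V : ι → Type} [∀ i, AddCommGroup (V i)]
  [∀ i, Fintype (V i)] {p : ℕ} [Fact p.Prime]

variable (V p) in
/-- The space of forms on `J`. -/
def formSub (J : Finset ι) : Submodule (ZMod p) ((∀ i, V i) → ZMod p) where
  carrier := {f | IsForm J f}
  add_mem' := IsForm.add
  zero_mem' := IsForm.zero J
  smul_mem' c _ hf := hf.smul c

/-- The linear map whose range is the ideal generated by `𝓗`. -/
noncomputable def idealMap (J : Finset ι) (𝓗 : Finset (Atom V p)) :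
    (∀ g : 𝓗, formSub V p (J \ g.1.1)) →ₗ[ZMod p] ((∀ i, V i) → ZMod p) where
  toFun b := ∑ g : 𝓗, g.1.2 * (b g : (∀ i, V i) → ZMod p)
  map_add' b c := by simp [mul_add, Finset.sum_add_distrib]
  map_smul' a b := by simp [Finset.smul_sum]

theorem mem_range_idealMap {J : Finset ι} {𝓗 : Finset (Atom V p)} {f : (∀ i, V i) → ZMod p} :
    f ∈ LinearMap.range (idealMap J 𝓗) ↔ InIdeal J 𝓗 f := by
  constructor
  · rintro ⟨b, rfl⟩
    refine ⟨fun g => if h : g ∈ 𝓗 then b ⟨g, h⟩ else 0, fun g hg => ?_, ?_⟩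
    · simp only [dif_pos hg]
      exact (b ⟨g, hg⟩).2
    · rw [← Finset.sum_coe_sort]
      refine Finset.sum_congr rfl fun g _ => ?_
      simp
  · rintro ⟨b, hb, rfl⟩
    refine ⟨fun g => ⟨b g, hb g g.2⟩, ?_⟩
    exact Finset.sum_coe_sort 𝓗 fun g => g.2 * b g

theorem InIdeal.mul_of_mem {J : Finset ι} {𝓗 : Finset (Atom V p)} {g : Atom V p} (hg : g ∈ 𝓗)
    {b : (∀ i, V i) → ZMod p} (hb : IsForm (J \ g.1) b) : InIdeal J 𝓗 (g.2 * b) := by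
  refine ⟨fun g' => if g' = g then b else 0, fun g' _ => ?_, ?_⟩
  · by_cases h : g' = g
    · subst h; simpa using hb
    · simpa [h] using IsForm.zero _
  · simp [hg]

theorem InIdeal.sum {J : Finset ι} {𝓗 : Finset (Atom V p)} {α : Type*} (s : Finset α)
    {f : α → (∀ i, V i) → ZMod p} (hf : ∀ l ∈ s, InIdeal J 𝓗 (f l)) :
    InIdeal J 𝓗 (∑ l ∈ s, f l) := by
  simp only [← mem_range_idealMap] at hf ⊢
  exact Submodule.sum_mem _ hf

theorem InIdeal.add {J : Finset ι} {𝓗 : Finset (Atom V p)} {f g : (∀ i, V i) → ZMod p}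
    (hf : InIdeal J 𝓗 f) (hg : InIdeal J 𝓗 g) : InIdeal J 𝓗 (f + g) := by
  rw [← mem_range_idealMap] at hf hg ⊢
  exact Submodule.add_mem _ hf hg

theorem InIdeal.mono {J : Finset ι} {𝓗 𝓖 : Finset (Atom V p)} (h : 𝓗 ⊆ 𝓖)
    {f : (∀ i, V i) → ZMod p} (hf : InIdeal J 𝓗 f) : InIdeal J 𝓖 f := by
  obtain ⟨b, hb, rfl⟩ := hf
  exact InIdeal.sum _ fun g hg => InIdeal.mul_of_mem (h hg) (hb g hg)

/-- If all slices of a form lie in an ideal, then so does the form. -/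
theorem InIdeal.of_slices {J : Finset ι} {i : ι} (hi : i ∈ J) {f : (∀ i, V i) → ZMod p}
    (hf : IsForm J f) {𝓗 : Finset (Atom V p)} (hV : Valid (J.erase i) 𝓗)
    (h : ∀ y : V i, InIdeal (J.erase i) 𝓗 (fun x => f (update x i y))) : InIdeal J 𝓗 f := by
  set Ψ := idealMap (J.erase i) 𝓗 with hΨ
  obtain ⟨ρ, hρ⟩ := LinearMap.exists_rightInverse_of_surjective Ψ.rangeRestrict
    Ψ.range_rangeRestrict
  let s : V i → LinearMap.range Ψ := fun y => ⟨_, mem_range_idealMap.2 (h y)⟩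
  have hs : ∀ a b, s (a + b) = s a + s b := fun a b => Subtype.ext (hf.slice_add hi a b)
  have hs2 : ∀ y, Ψ (ρ (s y)) = fun x => f (update x i y) := fun y =>
    congrArg Subtype.val (LinearMap.congr_fun hρ (s y))
  have hform : ∀ (g : 𝓗) (y : V i), IsForm (J.erase i \ g.1.1) (ρ (s y) g).1 :=
    fun g y => (ρ (s y) g).2
  refine mem_range_idealMap.1 ⟨fun g => ⟨fun x => (ρ (s (x i)) g).1 x, ?_, ?_⟩, ?_⟩
  · intro j hj x a b
    rw [mem_sdiff] at hj
    by_cases hji : j = i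
    · subst hji
      have hnot : j ∉ J.erase j \ g.1.1 := by simp
      simp only [update_self, (hform g _).2 j hnot, hs, map_add, Pi.add_apply, Submodule.coe_add]
    · have hj' : j ∈ J.erase i \ g.1.1 := mem_sdiff.2 ⟨mem_erase.2 ⟨hji, hj.1⟩, hj.2⟩
      simp only [update_of_ne (Ne.symm hji)]
      exact (hform g _).1 j hj' x a b
  · intro j hj x a
    have hji : j ≠ i := by
      rintro rfl
      rw [mem_sdiff, not_and_not_right] at hj
      exact notMem_erase _ _ ((hV g.1 g.2).2.1 (hj hi))
    have hj' : j ∉ J.erase i \ g.1.1 := by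
      rw [mem_sdiff] at hj ⊢
      exact fun h => hj ⟨mem_of_mem_erase h.1, h.2⟩
    simp only [update_of_ne (Ne.symm hji)]
    exact (hform g _).2 j hj' x a
  · ext x
    have := congrFun (hs2 (x i)) x
    rw [update_eq_self] at this
    rw [← this]
    change (∑ g : 𝓗, g.1.2 * fun x => (ρ (s (x i)) g).1 x) x =
      (∑ g : 𝓗, g.1.2 * (ρ (s (x i)) g).1) x
    simp only [Finset.sum_apply, Pi.mul_apply]

theorem monomial_not_ssubset {K : Finset ι} {𝓖 : Finset (Atom V p)} (hV : Valid K 𝓖)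
    {m n : Finset (Atom V p)} (hm : IsMonomial 𝓖 K m) (hn : IsMonomial 𝓖 K n) : ¬ m ⊂ n := by
  intro h
  obtain ⟨g, hg, hgm⟩ := Finset.exists_of_ssubset h
  obtain ⟨i, hi⟩ := (hV g (hn.1 hg)).1
  have : i ∈ m.biUnion Prod.fst := by
    rw [hm.2.2]; exact (hV g (hn.1 hg)).2.1 hi
  obtain ⟨g', hg', hi'⟩ := mem_biUnion.1 this
  have hne : g ≠ g' := by rintro rfl; exact hgm hg'
  exact Finset.disjoint_left.1 (hn.2.1 hg (h.1 hg') hne) hi hi'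

theorem monomial_card_le {K : Finset ι} {𝓖 : Finset (Atom V p)} (hV : Valid K 𝓖)
    {m : Finset (Atom V p)} (hm : IsMonomial 𝓖 K m) : m.card ≤ K.card := by
  rw [← hm.2.2, card_biUnion fun a ha b hb hab => hm.2.1 ha hb hab, card_eq_sum_ones]
  exact Finset.sum_le_sum fun g hg => (hV g (hm.1 hg)).1.card_pos

theorem inIdeal_of_meets {K : Finset ι} {𝓖 𝓗 : Finset (Atom V p)} (hV : Valid K 𝓖)
    (c : Finset (Atom V p) → ZMod p) (hc : ∀ m, c m ≠ 0 → IsMonomial 𝓖 K m)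
    (hmeet : ∀ m, c m ≠ 0 → ∃ g ∈ m, g ∈ 𝓗) : InIdeal K 𝓗 (∑ m, c m • monomialFun m) := by
  rw [← Finset.sum_filter_ne_zero]
  refine InIdeal.sum _ fun m hm => ?_
  have hcm : c m ≠ 0 := by
    intro h; rw [mem_filter, h, zero_smul] at hm; exact hm.2 rfl
  obtain ⟨g, hgm, hgH⟩ := hmeet m hcm
  have hm' := hc m hcm
  have heq : c m • monomialFun m = g.2 * (c m • monomialFun (m.erase g)) := by
    rw [mul_smul_comm, monomialFun, monomialFun, Finset.mul_prod_erase m _ hgm]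
  rw [heq]
  refine InIdeal.mul_of_mem hgH (IsForm.smul _ ?_)
  have h1 := isForm_monomialFun hV ((erase_subset g m).trans hm'.1)
    (hm'.2.1.subset (coe_subset.2 (erase_subset g m)))
  have h2 : (m.erase g).biUnion Prod.fst = K \ g.1 := by
    ext i
    rw [← hm'.2.2, mem_sdiff, mem_biUnion, mem_biUnion]
    constructor
    · rintro ⟨g', hg', hi⟩
      rw [mem_erase] at hg'
      exact ⟨⟨g', hg'.2, hi⟩, Finset.disjoint_left.1 (hm'.2.1 hg'.2 hgm hg'.1) hi⟩
    · rintro ⟨⟨g', hg', hi⟩, hni⟩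
      exact ⟨g', mem_erase.2 ⟨by rintro rfl; exact hni hi, hg'⟩, hi⟩
  rwa [h2] at h1

/-- A generated function that almost vanishes on an atom of `𝓗` lies in the ideal of `𝓗`. -/
theorem inIdeal_of_almost_zero {d : ℕ} {K : Finset ι} (hK : K.card ≤ d)
    {𝓖 𝓗 : Finset (Atom V p)} (hV : Valid K 𝓖) (hHG : 𝓗 ⊆ 𝓖)
    (hG : Regular (((p : ℝ) ^ 𝓖.card)⁻¹ / 2) 𝓖) (hH : Regular (((p : ℝ) ^ 𝓗.card)⁻¹) 𝓗)
    {θ : (∀ i, V i) → ZMod p} (hθ : Gen 𝓖 K θ) (x₀ : ∀ i, V i)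
    (h : count (fun x => (∀ g ∈ 𝓗, g.2 x = g.2 x₀) ∧ θ x ≠ 0) ≤
      (2 ^ (d + 3))⁻¹ * count (fun x => ∀ g ∈ 𝓗, g.2 x = g.2 x₀)) : InIdeal K 𝓗 θ := by
  have hp : (0 : ℝ) < p := by exact_mod_cast (Fact.out : p.Prime).pos
  have hN : 0 < size V := size_pos
  obtain ⟨c, hc, rfl⟩ := hθ.exists_coeff hV
  refine inIdeal_of_meets hV c hc fun π hπ => ?_
  by_contra! hdisj
  have hπm := hc π hπ
  set b : Atom V p → ZMod p := fun g => if g ∈ 𝓗 then g.2 x₀ else 0 with hb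
  have hcube := card_cube_le (𝓖 \ 𝓗) b π
    (fun g hg => mem_sdiff.2 ⟨hπm.1 hg, hdisj g hg⟩) c hπ (fun m hm => by
      by_contra hne
      exact monomial_not_ssubset hV hπm (hc m hne) hm)
  set C := (cube (𝓖 \ 𝓗) b).filter fun t => polyEval c t ≠ 0 with hC
  rw [card_cube, ZMod.card] at hcube
  have hcube' : p ^ (𝓖 \ 𝓗).card ≤ 2 ^ d * C.card := by
    refine le_trans ?_ (Nat.mul_le_mul_right C.card
      (Nat.pow_le_pow_right two_pos ((monomial_card_le hV hπm).trans hK)))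
    refine hcube.trans (le_of_eq ?_)
    rw [hC]
    congr!
  have hval : ∀ t x, (∀ g ∈ 𝓖, g.2 x = t g) → (∑ m, c m • monomialFun m) x = polyEval c t := by
    intro t x ht
    simp only [polyEval, Finset.sum_apply, Pi.smul_apply, smul_eq_mul, monomialFun,
      Finset.prod_apply]
    refine Finset.sum_congr rfl fun m _ => ?_
    by_cases hm : c m = 0
    · simp [hm]
    · rw [Finset.prod_congr rfl fun g hg => ht g ((hc m hm).1 hg)]
  have hfib : ∀ t : Atom V p → ZMod p, size V / (2 * (p : ℝ) ^ 𝓖.card) ≤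
      ((univ.filter fun x => ∀ g ∈ 𝓖, g.2 x = t g).card : ℝ) := by
    intro t
    have := (abs_le.1 (hG.equidistribution (by positivity) hV t)).1
    rw [count_eq] at this
    have e : size V / (2 * (p : ℝ) ^ 𝓖.card) =
        size V / (p : ℝ) ^ 𝓖.card - ((p : ℝ) ^ 𝓖.card)⁻¹ / 2 * size V := by
      field_simp; ring
    linarith
  have hbad : (C.card : ℝ) * (size V / (2 * (p : ℝ) ^ 𝓖.card)) ≤
      count (fun x => (∀ g ∈ 𝓗, g.2 x = g.2 x₀) ∧ (∑ m, c m • monomialFun m) x ≠ 0) := by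
    have hsub : (C.biUnion fun t => univ.filter fun x => ∀ g ∈ 𝓖, g.2 x = t g) ⊆
        univ.filter fun x => (∀ g ∈ 𝓗, g.2 x = g.2 x₀) ∧
          (∑ m, c m • monomialFun m) x ≠ 0 := by
      intro x hx
      obtain ⟨t, ht, hx⟩ := mem_biUnion.1 hx
      rw [mem_filter] at hx ht ⊢
      refine ⟨mem_univ _, fun g hg => ?_, ?_⟩
      · rw [hx.2 g (hHG hg), mem_cube.1 ht.1 g fun h => (mem_sdiff.1 h).2 hg, hb]
        simp [hg]
      · rw [hval t x hx.2]; exact ht.2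
    have hdis : (C : Set (Atom V p → ZMod p)).PairwiseDisjoint
        fun t => univ.filter fun x : ∀ i, V i => ∀ g ∈ 𝓖, g.2 x = t g := by
      intro t ht t' ht' hne
      refine Finset.disjoint_left.2 fun x hx hx' => hne (funext fun g => ?_)
      rw [mem_filter] at hx hx'
      by_cases hg : g ∈ 𝓖
      · rw [← hx.2 g hg, hx'.2 g hg]
      · have hg' : g ∉ 𝓖 \ 𝓗 := fun h => hg (mem_sdiff.1 h).1
        rw [mem_cube.1 (mem_filter.1 (mem_coe.1 ht)).1 g hg',
          mem_cube.1 (mem_filter.1 (mem_coe.1 ht')).1 g hg']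
    rw [count_eq]
    have h1 := card_le_card hsub
    rw [card_biUnion hdis] at h1
    have h2 : (∑ t ∈ C, ((univ.filter fun x => ∀ g ∈ 𝓖, g.2 x = t g).card : ℝ)) ≤
        ((univ.filter fun x => (∀ g ∈ 𝓗, g.2 x = g.2 x₀) ∧
          (∑ m, c m • monomialFun m) x ≠ 0).card : ℝ) := by exact_mod_cast h1
    refine le_trans ?_ h2
    rw [← nsmul_eq_mul, ← sum_const]
    exact Finset.sum_le_sum fun t _ => hfib t
  have hatom : count (fun x => ∀ g ∈ 𝓗, g.2 x = g.2 x₀) ≤ 2 * (size V / (p : ℝ) ^ 𝓗.card) := by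
    have := (abs_le.1 (hH.equidistribution (by positivity) (fun g hg => hV g (hHG hg))
      (fun g => g.2 x₀))).2
    have e : ((p : ℝ) ^ 𝓗.card)⁻¹ * size V = size V / (p : ℝ) ^ 𝓗.card := by
      rw [div_eq_inv_mul]
    linarith
  have hpow : (p : ℝ) ^ 𝓖.card = (p : ℝ) ^ (𝓖 \ 𝓗).card * (p : ℝ) ^ 𝓗.card := by
    rw [← pow_add, card_sdiff_add_card_eq_card hHG]
  have hC' : (p : ℝ) ^ (𝓖 \ 𝓗).card ≤ 2 ^ d * C.card := by exact_mod_cast hcube'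
  set X := size V / (p : ℝ) ^ 𝓗.card with hX
  have hXpos : 0 < X := by positivity
  have h3 : size V / (2 * (p : ℝ) ^ 𝓖.card) = X / (2 * (p : ℝ) ^ (𝓖 \ 𝓗).card) := by
    rw [hX, hpow]; field_simp
  rw [h3] at hbad
  have h4 : X / (2 * 2 ^ d) ≤ C.card * (X / (2 * (p : ℝ) ^ (𝓖 \ 𝓗).card)) := by
    rw [← mul_div_assoc, div_le_div_iff₀ (by positivity) (by positivity)]
    nlinarith
  have h5 : (2 ^ (d + 3))⁻¹ * (2 * X) = X / (2 * 2 ^ d) / 2 := by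
    rw [pow_add]; field_simp
  have h6 : (0 : ℝ) < X / (2 * 2 ^ d) := by positivity
  have h7 := mul_le_mul_of_nonneg_left hatom (show (0 : ℝ) ≤ (2 ^ (d + 3))⁻¹ by positivity)
  linarith

end Ideal

section Step

variable {ι : Type} [Fintype ι] [DecidableEq ι] {V : ι → Type} [∀ i, AddCommGroup (V i)]
  [∀ i, Fintype (V i)] {p : ℕ} [Fact p.Prime]

/-- Boundedly many functions of bounded partition rank are generated by a regular family. -/
theorem exists_regular_family {d r s N : ℕ} {κ : ℕ → ℝ} {κ₀ : ℝ}
    (hreg : Regularizable p d κ 0 (fun _ => s * (2 * r)) N κ₀) {α : Type} (Y : Finset α)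
    (hY : Y.card ≤ s) {K : Finset ι} (hK : K.card ≤ d) (f : α → (∀ i, V i) → ZMod p)
    (hf : ∀ y ∈ Y, PRank K r (f y)) :
    ∃ 𝓗 : Finset (Atom V p), Valid K 𝓗 ∧ 𝓗.card ≤ N ∧ Regular (κ 𝓗.card) 𝓗 ∧
      ∀ y ∈ Y, Gen 𝓗 K (f y) := by
  choose! 𝓐 hcard hV _ hgen using fun y hy => (hf y hy).exists_gen
  obtain ⟨𝓗, -, hVH, hH, hR, hN⟩ := hreg ι V K ∅ (Y.biUnion 𝓐) hK (by simp [Valid])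
    (fun g hg => by
      obtain ⟨y, hy, hg⟩ := mem_biUnion.1 hg
      exact hV y hy g hg) (by simp) (by simp [Regular]) (fun l => by
      refine (card_filter_le _ _).trans (card_biUnion_le.trans ?_)
      refine (Finset.sum_le_card_nsmul _ _ _ hcard).trans ?_
      rw [smul_eq_mul]
      exact Nat.mul_le_mul_right _ hY)
  exact ⟨𝓗, hVH, hH, hR, fun y hy => (hgen y hy).trans fun g hg => hN g
    (mem_biUnion.2 ⟨y, hy, hg⟩)⟩

/-- A function of bounded partition rank almost vanishing on a union of atoms of a sufficiently
regular family lies in the ideal of this family. -/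
theorem inIdeal_of_almost_zero_on {d r N : ℕ} {κ₀ : ℝ} {K : Finset ι} (hK : K.card ≤ d)
    {𝓗 : Finset (Atom V p)} (hV : Valid K 𝓗)
    (hreg : Regularizable p d (fun n => ((p : ℝ) ^ n)⁻¹ / 2) 𝓗.card (fun _ => 2 * r) N κ₀)
    (hH : Regular κ₀ 𝓗) (hH' : Regular (((p : ℝ) ^ 𝓗.card)⁻¹) 𝓗)
    {θ : (∀ i, V i) → ZMod p} (hθ : PRank K r θ) (Z : Finset (∀ i, V i)) (hZ : Z.Nonempty)
    (hZH : ∀ x x', (∀ g ∈ 𝓗, g.2 x = g.2 x') → x' ∈ Z → x ∈ Z)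
    (h : ((Z.filter fun x => θ x ≠ 0).card : ℝ) ≤ (2 ^ (d + 3))⁻¹ * Z.card) :
    InIdeal K 𝓗 θ := by
  obtain ⟨𝓐, hcard, hVA, -, hgen⟩ := hθ.exists_gen
  obtain ⟨𝓖, hHG, hVG, -, hR, hN⟩ := hreg ι V K 𝓗 𝓐 hK hV hVA le_rfl hH
    fun l => (card_filter_le _ _).trans hcard
  obtain ⟨x₀, hx₀, hfib⟩ := exists_fiber Z hZ
    (fun x => fun g : Atom V p => if g ∈ 𝓗 then g.2 x else 0) (fun x => θ x ≠ 0) (by convert h)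
  have hiff : ∀ x : ∀ i, V i, ((fun g : Atom V p => if g ∈ 𝓗 then g.2 x else 0) =
      fun g : Atom V p => if g ∈ 𝓗 then g.2 x₀ else 0) ↔ ∀ g ∈ 𝓗, g.2 x = g.2 x₀ := by
    intro x
    constructor
    · intro he g hg
      simpa [hg] using congrFun he g
    · intro he
      funext g
      by_cases hg : g ∈ 𝓗
      · simp [hg, he g hg]
      · simp [hg]
  refine inIdeal_of_almost_zero hK hVG hHG hR hH' (hgen.trans hN) x₀ ?_
  simp only [hiff] at hfib
  have e1 : (Z.filter fun x => (∀ g ∈ 𝓗, g.2 x = g.2 x₀) ∧ θ x ≠ 0) =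
      univ.filter fun x => (∀ g ∈ 𝓗, g.2 x = g.2 x₀) ∧ θ x ≠ 0 := by
    ext x
    simp only [mem_filter, mem_univ, true_and, and_iff_right_iff_imp]
    exact fun hx => hZH x x₀ hx.1 hx₀
  have e2 : (Z.filter fun x => ∀ g ∈ 𝓗, g.2 x = g.2 x₀) =
      univ.filter fun x => ∀ g ∈ 𝓗, g.2 x = g.2 x₀ := by
    ext x
    simp only [mem_filter, mem_univ, true_and, and_iff_right_iff_imp]
    exact fun hx => hZH x x₀ hx hx₀
  rw [count_eq, count_eq]
  rw [e1, e2] at hfib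
  exact hfib

/-- If a dense set of slices lies in the ideal of `𝓗`, the form has bounded partition rank. -/
theorem prank_of_dense_slices {J : Finset ι} {i : ι} (hi : i ∈ J) (hJ : (J.erase i).Nonempty)
    {f : (∀ i, V i) → ZMod p} (hf : IsForm J f) {𝓗 : Finset (Atom V p)}
    (hV : Valid (J.erase i) 𝓗) {ε : ℝ} (hε : 0 < ε) (S : Finset (V i))
    (hS : ε / 2 * Fintype.card (V i) ≤ (S.card : ℝ))
    (hSH : ∀ y ∈ S, InIdeal (J.erase i) 𝓗 (fun x => f (update x i y))) :
    PRank J (𝓗.card + ⌈2 / ε⌉₊) f := by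
  let sl : V i →+ ((∀ i, V i) → ZMod p) :=
    AddMonoidHom.mk' (fun y x => f (update x i y)) (hf.slice_add hi)
  let T : AddSubgroup (V i) := (LinearMap.range (idealMap (J.erase i) 𝓗)).toAddSubgroup.comap sl
  have hT : ∀ y, y ∈ T ↔ InIdeal (J.erase i) 𝓗 (fun x => f (update x i y)) :=
    fun y => mem_range_idealMap
  have hindex := index_le_of_dense T S (fun y hy => (hT y).2 (hSH y hy)) hε hS
  let e : V i ⧸ T → Atom V p := fun q => (J.erase i, fun x => f (update x i q.out))
  set 𝓗' := 𝓗 ∪ univ.image e with h𝓗'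
  have hV' : Valid (J.erase i) 𝓗' := hV.union fun g hg => by
    obtain ⟨q, -, rfl⟩ := mem_image.1 hg
    exact ⟨hJ, Subset.rfl, hf.slice i _⟩
  refine ⟨𝓗', ?_, hV'.mono (erase_subset _ _), fun g hg h => ?_, ?_⟩
  · refine (card_union_le _ _).trans (Nat.add_le_add_left ?_ _)
    refine card_image_le.trans ?_
    have h1 : (univ : Finset (V i ⧸ T)).card = T.index := by
      rw [card_univ, ← Nat.card_eq_fintype_card]; rfl
    rw [h1]
    exact_mod_cast hindex.trans (Nat.le_ceil _)
  · exact notMem_erase i J ((hV' g hg).2.1 (h.symm ▸ hi))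
  · refine InIdeal.of_slices hi hf hV' fun y => ?_
    have hy : y - (QuotientAddGroup.mk y : V i ⧸ T).out ∈ T := by
      rw [← QuotientAddGroup.eq_zero_iff, QuotientAddGroup.mk_sub, sub_eq_zero]
      exact (Quotient.out_eq' _).symm
    have h1 := ((hT _).1 hy).mono (J := J.erase i) (𝓖 := 𝓗') subset_union_left
    have h2 : InIdeal (J.erase i) 𝓗'
        (fun x => f (update x i (QuotientAddGroup.mk y : V i ⧸ T).out)) := by
      have := InIdeal.mul_of_mem (J := J.erase i) (𝓗 := 𝓗') (g := e (QuotientAddGroup.mk y))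
        (mem_union_right _ (mem_image_of_mem _ (mem_univ _))) (b := 1)
        (by simpa [e] using isForm_one V p)
      simpa only [mul_one] using this
    have h3 := h1.add h2
    rwa [← hf.slice_add hi, sub_add_cancel] at h3

end Step

variable {p : ℕ} [Fact p.Prime]

theorem good_one : Good p 1 := by
  intro ε hε
  refine ⟨0, fun ι _ _ V _ _ J f hJ hf h => ?_⟩
  obtain ⟨i, rfl⟩ := card_eq_one.1 hJ
  have hi : i ∈ ({i} : Finset ι) := mem_singleton_self i
  rw [hf.norm_expSum _ hi] at h
  have hpos : 0 < count (fun x : ∀ i, V i => ∀ v, ZMod.toCircle (f (update x i v)) = 1) :=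
    (mul_pos hε size_pos).trans_le h
  rw [count_eq, Nat.cast_pos, card_pos] at hpos
  obtain ⟨x, hx⟩ := hpos
  simp only [mem_filter, mem_univ, true_and, toCircle_eq_one_iff] at hx
  refine ⟨∅, by simp, by simp [Valid], by simp, 0, by simp, ?_⟩
  ext y
  have := hf.congr_of_eqOn (x := y) (y := update x i (y i)) (by simp)
  simp [this, hx]

theorem good_succ {d : ℕ} (hd : 1 ≤ d) (hGood : ∀ n, 1 ≤ n → n ≤ d → Good p n) :
    Good p (d + 1) := by
  intro ε hε
  have hp : (0 : ℝ) < p := by exact_mod_cast (Fact.out : p.Prime).pos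
  obtain ⟨r₁, hr₁⟩ := hGood d hd le_rfl (ε / 2) (by positivity)
  obtain ⟨s, hs⟩ := exists_pow_lt_of_lt_one hε
    (show (1 : ℝ) - (2 ^ (d + 3))⁻¹ < 1 by
      have : (0 : ℝ) < (2 ^ (d + 3))⁻¹ := by positivity
      linarith)
  choose N₂ κ₂ hκ₂ hreg₂ using fun m => exists_regularizable d hGood
    (fun n => ((p : ℝ) ^ n)⁻¹ / 2) (fun n => by positivity) m (fun _ => 2 * r₁)
  obtain ⟨N₁, _, _, hreg₁⟩ := exists_regularizable d hGood
    (fun m => min (κ₂ m) ((p : ℝ) ^ m)⁻¹) (fun m => lt_min (hκ₂ m) (by positivity)) 0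
    (fun _ => s * (2 * r₁))
  refine ⟨N₁ + ⌈2 / ε⌉₊, fun ι _ _ V _ _ J f hJ hf h => ?_⟩
  obtain ⟨i, hi⟩ : J.Nonempty := card_pos.1 (by omega)
  have hK : (J.erase i).card = d := by rw [card_erase_of_mem hi]; omega
  set S := univ.filter fun y : V i =>
    ε / 2 * size V ≤ ‖expSum (ZMod.toCircle (N := p)) (fun x => f (update x i y))‖ with hS
  have hrank : ∀ y ∈ S, PRank (J.erase i) r₁ (fun x => f (update x i y)) := fun y hy =>
    hr₁ ι V _ _ hK (hf.slice i y) (mem_filter.1 hy).2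
  have hη : ((2 : ℝ) ^ (d + 3))⁻¹ ≤ 1 := inv_le_one_of_one_le₀ (one_le_pow₀ one_le_two)
  obtain ⟨Y, hYS, hY, hor⟩ := exists_greedy S (fun y x => f (update x i y) ≠ 0) hη s
  set Z := univ.filter fun x => ∀ z ∈ Y, ¬ f (update x i z) ≠ 0 with hZ
  have hZcard : ε * size V ≤ Z.card := by
    refine h.trans ?_
    rw [hf.norm_expSum _ hi, count_eq]
    refine Nat.cast_le.2 (card_le_card fun x hx => ?_)
    simp only [hZ, mem_filter, mem_univ, true_and, toCircle_eq_one_iff, not_not] at hx ⊢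
    exact fun z _ => hx z
  have hZne : Z.Nonempty := by
    rw [← card_pos, ← Nat.cast_pos (α := ℝ)]
    exact (mul_pos hε size_pos).trans_le hZcard
  have hgreedy := hor.resolve_right fun hle => by
    have hle' : (Z.card : ℝ) ≤ (1 - (2 ^ (d + 3))⁻¹) ^ s * Fintype.card (∀ i, V i) := by
      convert hle
    have h1 := hZcard.trans hle'
    have h2 := mul_lt_mul_of_pos_right hs (size_pos (V := V))
    unfold size at h1 h2
    linarith
  obtain ⟨𝓗, hV, hcard, hR, hgen⟩ := exists_regular_family hreg₁ Y hY hK.le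
    (fun y x => f (update x i y)) fun y hy => hrank y (hYS hy)
  have key := prank_of_dense_slices hi (card_pos.1 (by omega)) hf hV hε S
    (dense_slices _ i f h) fun y hy => by
      refine inIdeal_of_almost_zero_on hK.le hV (hreg₂ 𝓗.card) (hR.mono (min_le_left _ _))
        (hR.mono (min_le_right _ _)) (hrank y hy) Z hZne (fun x x' hx hx' => ?_) ?_
      · simp only [hZ, mem_filter, mem_univ, true_and, not_not] at hx' ⊢
        exact fun z hz => ((hgen z hz).congr hx).trans (hx' z hz)
      · rw [hZ, filter_filter]
        convert hgreedy y hy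
  obtain ⟨𝓐, h1, h2, h3, h4⟩ := key
  exact ⟨𝓐, h1.trans (Nat.add_le_add_right hcard _), h2, h3, h4⟩

variable (p) in
theorem good (n : ℕ) (hn : 1 ≤ n) : Good p n := by
  induction n using Nat.strong_induction_on with
  | _ n ih =>
    rcases Nat.exists_eq_add_of_le' hn with ⟨d, rfl⟩
    rcases Nat.eq_zero_or_pos d with rfl | hd
    · exact good_one
    · exact good_succ hd fun m h1 h2 => ih m (Nat.lt_succ_of_le h2) h1

section Tensor

variable {ι : Type} [Fintype ι] [DecidableEq ι] {A : ι → Type} [∀ i, AddCommGroup (A i)]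
  {J : ι → Type} [∀ i, Fintype (J i)] {R : Type} [CommRing R]

/-- The multilinear map with coefficients `u` in the coordinates `c`. -/
def tensorForm (c : ∀ i, J i → A i →+ R) (u : (∀ i, J i) → R) (x : ∀ i, A i) : R :=
  ∑ j, u j * ∏ i, c i (j i) (x i)

theorem isMultiadditive_tensorForm (c : ∀ i, J i → A i →+ R) (u : (∀ i, J i) → R) :
    IsMultiadditive (tensorForm c u) := by
  intro i x a b
  simp only [tensorForm, ← Finset.sum_add_distrib, ← mul_add]
  refine Finset.sum_congr rfl fun j _ => congrArg _ ?_
  have h : ∀ y : A i, ∏ l, c l (j l) (update x i y l) =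
      c i (j i) y * ∏ l ∈ univ.erase i, c l (j l) (x l) := by
    intro y
    rw [← Finset.mul_prod_erase univ _ (mem_univ i), update_self]
    congr 1
    exact Finset.prod_congr rfl fun l hl => by rw [update_of_ne (ne_of_mem_erase hl)]
  rw [h, h, h, map_add, add_mul]

theorem tensorForm_add (c : ∀ i, J i → A i →+ R) (u v : (∀ i, J i) → R) (x : ∀ i, A i) :
    tensorForm c (fun j => u j + v j) x = tensorForm c u x + tensorForm c v x := by
  simp only [tensorForm, add_mul, Finset.sum_add_distrib]

theorem tensorForm_sum (c : ∀ i, J i → A i →+ R) {α : Type*} (s : Finset α)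
    (u : α → (∀ i, J i) → R) (x : ∀ i, A i) :
    tensorForm c (fun j => ∑ l ∈ s, u l j) x = ∑ l ∈ s, tensorForm c (u l) x := by
  simp only [tensorForm, Finset.sum_mul]
  exact Finset.sum_comm

theorem tensorForm_mul (c : ∀ i, J i → A i →+ R) (t : R) (u : (∀ i, J i) → R) (x : ∀ i, A i) :
    tensorForm c (fun j => t * u j) x = t * tensorForm c u x := by
  simp only [tensorForm, Finset.mul_sum, mul_assoc]

/-- Restriction of a tuple of indices to a set of coordinates and its complement. -/
def splitEquiv (J : ι → Type) (I : Finset ι) :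
    (∀ i, J i) ≃ (∀ i : I, J i) × (∀ i : (Iᶜ : Finset ι), J i) where
  toFun j := (fun i => j i, fun i => j i)
  invFun z i := if h : i ∈ I then z.1 ⟨i, h⟩ else z.2 ⟨i, mem_compl.2 h⟩
  left_inv j := by ext i; simp
  right_inv z := by
    refine Prod.ext (funext fun i => ?_) (funext fun i => ?_)
    · simp
    · have := mem_compl.1 i.2
      simp [this]

theorem exists_split (c : ∀ i, J i → A i →+ R) (I : Finset ι) (u v : (∀ i, J i) → R)
    (hu : DependsOn u I) (hv : DependsOn v (Iᶜ : Finset ι)) :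
    ∃ (U : (∀ i : I, A i) → R) (W : (∀ i : (Iᶜ : Finset ι), A i) → R),
      IsMultiadditive U ∧ IsMultiadditive W ∧
      ∀ x, tensorForm c (fun j => u j * v j) x = U (fun i => x i) * W (fun i => x i) := by
  rcases isEmpty_or_nonempty (∀ i, J i) with hJ | ⟨⟨j₀⟩⟩
  · exact ⟨0, 0, fun _ _ _ _ => by simp, fun _ _ _ _ => by simp, fun x => by simp [tensorForm]⟩
  set E := splitEquiv J I with hE
  refine ⟨tensorForm (fun i j => c i j) (fun a => u (E.symm (a, (E j₀).2))),
    tensorForm (fun i j => c i j) (fun b => v (E.symm ((E j₀).1, b))),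
    isMultiadditive_tensorForm _ _, isMultiadditive_tensorForm _ _, fun x => ?_⟩
  simp only [tensorForm]
  rw [Finset.sum_mul_sum, ← Fintype.sum_prod_type', ← E.symm.sum_comp]
  refine Finset.sum_congr rfl fun z _ => ?_
  have h1 : u (E.symm z) = u (E.symm (z.1, (E j₀).2)) := hu fun i hi => by
    have hi : i ∈ I := hi
    simp [hE, splitEquiv, hi]
  have h2 : v (E.symm z) = v (E.symm ((E j₀).1, z.2)) := hv fun i hi => by
    have hi : i ∉ I := mem_compl.1 (mem_coe.1 hi)
    simp [hE, splitEquiv, hi]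
  have h3 : ∏ i, c i (E.symm z i) (x i) =
      (∏ i : I, c i (z.1 i) (x i)) * ∏ i : (Iᶜ : Finset ι), c i (z.2 i) (x i) := by
    rw [← Finset.prod_mul_prod_compl I, ← Finset.prod_coe_sort I, ← Finset.prod_coe_sort Iᶜ]
    congr 1
    · refine Finset.prod_congr rfl fun i _ => ?_
      simp [hE, splitEquiv]
    · refine Finset.prod_congr rfl fun i _ => ?_
      have := mem_compl.1 i.2
      simp [hE, splitEquiv, this]
  rw [h1, h2, h3]
  ring

theorem isForm_univ {B : Type} [AddCommGroup B] {f : (∀ i, A i) → B}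
    (hf : IsMultiadditive f) : IsForm univ f :=
  ⟨fun i _ x a b => hf i x a b, fun i hi => absurd (mem_univ i) hi⟩

theorem isForm_restrict {B : Type} [AddCommGroup B] {I : Finset ι} {f : (∀ i : I, A i) → B}
    (hf : IsMultiadditive f) : IsForm I (fun x : ∀ i, A i => f fun i => x i) := by
  have h : ∀ (i : ι) (hi : i ∈ I) (x : ∀ i, A i) (a : A i),
      (fun l : I => update x i a l) = update (fun l : I => x l) ⟨i, hi⟩ a := by
    intro i hi x a
    funext l
    by_cases hl : l = ⟨i, hi⟩
    · subst hl; simp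
    · rw [update_of_ne hl, update_of_ne fun h => hl (Subtype.ext h)]
  refine ⟨fun i hi x a b => ?_, fun i hi x a => congrArg f (funext fun l => ?_)⟩
  · simp only [h i hi, hf ⟨i, hi⟩]
  · rw [update_of_ne]
    rintro rfl
    exact hi l.2

variable [∀ i, Fintype (A i)]

/-- Adding a product of two forms increases a character sum at most by a factor `q`. -/
theorem norm_expSum_add_mul_le {q : ℕ} [NeZero q] {θ a b : (∀ i, A i) → ZMod q}
    (hθ : IsForm univ θ) {I : Finset ι} (hI : I.Nonempty) (hI' : I ≠ univ) (ha : IsForm I a)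
    (hb : IsForm Iᶜ b) : ‖expSum (ZMod.toCircle (N := q)) (θ + a * b)‖ ≤
      q * ‖expSum (ZMod.toCircle (N := q)) θ‖ := by
  have hq : (0 : ℝ) < q := by exact_mod_cast NeZero.pos q
  have hbound : ∀ s t : ZMod q, ‖expSum (ZMod.toCircle (N := q)) (θ + (s • a + t • b))‖ ≤
      ‖expSum (ZMod.toCircle (N := q)) θ‖ := by
    intro s t
    have := norm_expSum_add_sum_le (ZMod.toCircle (N := q)) hθ (univ : Finset Bool)
      (fun l => if l then I else Iᶜ) (fun l => if l then s • a else t • b) (fun l _ => by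
        cases l
        · simpa using hb.smul t
        · simpa using ha.smul s) (fun l _ h => by
        cases l
        · obtain ⟨i, hi⟩ := hI
          have := h (mem_univ i)
          simp [hi] at this
        · exact hI' (univ_subset_iff.1 (by simpa using h)))
    simpa using this
  have hexp : ∀ x, (q : ℂ) * (ZMod.toCircle ((θ + a * b) x) : ℂ) =
      ∑ t : ZMod q, ∑ s : ZMod q, (ZMod.toCircle (-(s * t)) : ℂ) *
        (ZMod.toCircle ((θ + (s • a + t • b)) x) : ℂ) := by
    intro x
    have h1 : ∀ t : ZMod q, ∑ s : ZMod q, (ZMod.toCircle (-(s * t)) : ℂ) *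
        (ZMod.toCircle ((θ + (s • a + t • b)) x) : ℂ) =
        (ZMod.toCircle (θ x + t * b x) : ℂ) * if a x = t then (q : ℂ) else 0 := by
      intro t
      have h2 := sum_toCircle_mul (a x - t)
      simp only [sub_eq_zero] at h2
      rw [← h2, Finset.mul_sum]
      refine Finset.sum_congr rfl fun s _ => ?_
      rw [← Circle.coe_mul, ← Circle.coe_mul, ← AddChar.map_add_eq_mul, ← AddChar.map_add_eq_mul]
      congr 2
      simp only [Pi.add_apply, Pi.smul_apply, smul_eq_mul]
      ring
    simp only [h1, mul_ite, mul_zero, Finset.sum_ite_eq, mem_univ, if_true]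
    rw [mul_comm]
    simp
  have hS : (q : ℂ) * expSum (ZMod.toCircle (N := q)) (θ + a * b) =
      ∑ t : ZMod q, ∑ s : ZMod q, (ZMod.toCircle (-(s * t)) : ℂ) *
        expSum (ZMod.toCircle (N := q)) (θ + (s • a + t • b)) := by
    simp only [expSum, Finset.mul_sum]
    rw [Finset.sum_congr rfl fun x _ => hexp x, Finset.sum_comm]
    exact Finset.sum_congr rfl fun t _ => Finset.sum_comm
  have hnorm : (q : ℝ) * ‖expSum (ZMod.toCircle (N := q)) (θ + a * b)‖ ≤
      q * (q * ‖expSum (ZMod.toCircle (N := q)) θ‖) := by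
    calc _ = ‖(q : ℂ) * expSum (ZMod.toCircle (N := q)) (θ + a * b)‖ := by simp
      _ ≤ ∑ t : ZMod q, ∑ s : ZMod q, ‖expSum (ZMod.toCircle (N := q)) θ‖ := by
        rw [hS]
        refine (norm_sum_le _ _).trans (Finset.sum_le_sum fun t _ => (norm_sum_le _ _).trans
          (Finset.sum_le_sum fun s _ => ?_))
        rw [norm_mul, Circle.norm_coe, one_mul]
        exact hbound s t
      _ = _ := by simp [ZMod.card]
  exact le_of_mul_le_mul_left hnorm hq

theorem norm_expSum_add_sum_mul_le {q : ℕ} [NeZero q] {θ : (∀ i, A i) → ZMod q}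
    (hθ : IsForm univ θ) {α : Type} (s : Finset α) (I : α → Finset ι)
    (a b : α → (∀ i, A i) → ZMod q) (hI : ∀ l ∈ s, (I l).Nonempty ∧ I l ≠ univ)
    (ha : ∀ l ∈ s, IsForm (I l) (a l)) (hb : ∀ l ∈ s, IsForm (I l)ᶜ (b l)) :
    ‖expSum (ZMod.toCircle (N := q)) (θ + ∑ l ∈ s, a l * b l)‖ ≤
      q ^ s.card * ‖expSum (ZMod.toCircle (N := q)) θ‖ := by
  induction s using Finset.induction_on with
  | empty => simp
  | insert l s hl ih =>
    rw [forall_mem_insert] at hI ha hb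
    rw [Finset.sum_insert hl, add_comm (a l * b l), ← add_assoc, card_insert_of_notMem hl]
    have hform : IsForm univ (θ + ∑ l ∈ s, a l * b l) :=
      hθ.add (IsForm.sum _ fun l hl => by
        have := (ha.2 l hl).mul (disjoint_compl_right) (hb.2 l hl)
        rwa [union_compl] at this)
    refine (norm_expSum_add_mul_le hform hI.1.1 hI.1.2 ha.1 hb.1).trans ?_
    rw [pow_succ', mul_assoc]
    exact mul_le_mul_of_nonneg_left (ih hI.2 ha.2 hb.2) (Nat.cast_nonneg _)

end Tensor

section Array

/-- A coordinate of `J → ZMod L`, reduced modulo `q`. -/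
def coordHom {q L : ℕ} (h : q ∣ L) {J : Type} (j : J) : (J → ZMod L) →+ ZMod q :=
  (ZMod.castHom h (ZMod q)).toAddMonoidHom.comp (Pi.evalAddMonoidHom (fun _ => ZMod L) j)

theorem coordHom_apply {q L : ℕ} (h : q ∣ L) {J : Type} (j : J) (x : J → ZMod L) :
    coordHom h j x = ZMod.castHom h (ZMod q) (x j) := rfl

variable {ι : Type} [Fintype ι] [DecidableEq ι] {J : ι → Type} [∀ i, Fintype (J i)]

/-- The multilinear map given by an integer array, reduced modulo `q`. -/
def arrayForm {q L : ℕ} (h : q ∣ L) (a : (∀ i, J i) → ℤ) : (∀ i, J i → ZMod L) → ZMod q :=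
  tensorForm (fun _ j => coordHom h j) fun j => (a j : ZMod q)

theorem isForm_arrayForm {q L : ℕ} (h : q ∣ L) (a : (∀ i, J i) → ℤ) :
    IsForm univ (arrayForm h a) :=
  isForm_univ (isMultiadditive_tensorForm _ _)

theorem castHom_arrayForm {q q' L : ℕ} (h : q ∣ L) (h' : q' ∣ q) (a : (∀ i, J i) → ℤ)
    (x : ∀ i, J i → ZMod L) :
    ZMod.castHom h' (ZMod q') (arrayForm h a x) = arrayForm (h'.trans h) a x := by
  simp only [arrayForm, tensorForm, map_sum, map_mul, map_prod, map_intCast, coordHom_apply]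
  have hc : (ZMod.castHom h' (ZMod q')).comp (ZMod.castHom h (ZMod q)) =
      ZMod.castHom (h'.trans h) (ZMod q') := RingHom.ext_zmod _ _
  simp only [← RingHom.comp_apply, hc]

theorem toCircle_natCast_mul {p q : ℕ} [NeZero p] [NeZero q] (z : ZMod (p * q)) :
    ZMod.toCircle ((p : ZMod (p * q)) * z) =
      ZMod.toCircle (ZMod.castHom (dvd_mul_left q p) (ZMod q) z) := by
  obtain ⟨n, rfl⟩ := ZMod.intCast_surjective z
  apply Circle.ext
  rw [map_intCast, ← Int.cast_natCast, ← Int.cast_mul, ZMod.toCircle_intCast,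
    ZMod.toCircle_intCast]
  congr 1
  have hp : (p : ℂ) ≠ 0 := by exact_mod_cast NeZero.ne p
  have hq : (q : ℂ) ≠ 0 := by exact_mod_cast NeZero.ne q
  push_cast
  field_simp

/-- The points of the standard basis. -/
noncomputable def basisPoint (L : ℕ) (j : ∀ i, J i) : ∀ i, J i → ZMod L :=
  fun i => Pi.single (j i) 1

theorem arrayForm_basisPoint {q L : ℕ} (h : q ∣ L) (a : (∀ i, J i) → ℤ) (j : ∀ i, J i) :
    arrayForm h a (basisPoint L j) = a j := by
  simp only [arrayForm, tensorForm, coordHom_apply, basisPoint]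
  rw [Finset.sum_eq_single j]
  · simp [-ZMod.castHom_apply]
  · intro j' _ hj
    obtain ⟨i, hi⟩ := Function.ne_iff.1 hj
    rw [Finset.prod_eq_zero (mem_univ i), mul_zero]
    simp [hi]
  · simp

/-- The array `a` is, modulo `q`, a sum of at most `r` products of arrays depending on
complementary sets of indices. -/
def ArrayDecomp (q r : ℕ) (a : (∀ i, J i) → ℤ) : Prop :=
  ∃ (α : Type) (_ : Fintype α) (I : α → Finset ι) (u v : α → (∀ i, J i) → ℤ),
    Fintype.card α ≤ r ∧ (∀ l, (I l).Nonempty ∧ I l ≠ univ ∧ DependsOn (u l) (I l) ∧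
      DependsOn (v l) ((I l)ᶜ : Finset ι)) ∧ ∀ j, (q : ℤ) ∣ a j - ∑ l, u l j * v l j

theorem arrayDecomp_of_prank {p L : ℕ} [Fact p.Prime] [NeZero L] (h : p ∣ L)
    (a : (∀ i, J i) → ℤ) {r : ℕ} (hr : PRank univ r (arrayForm h a)) : ArrayDecomp p r a := by
  obtain ⟨𝓐, hcard, hV, hne, b, hb, hsum⟩ := hr
  refine ⟨𝓐, inferInstance, fun g => g.1.1, fun g j => ((g.1.2 (basisPoint L j)).val : ℤ),
    fun g j => ((b g (basisPoint L j)).val : ℤ), by simpa using hcard, fun g => ?_, fun j => ?_⟩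
  · refine ⟨(hV g g.2).1, hne g g.2, fun j j' hj => ?_, fun j j' hj => ?_⟩
    · have := (hV g g.2).2.2.congr_of_eqOn (x := basisPoint L j) (y := basisPoint L j')
        fun i hi => by rw [basisPoint, basisPoint, hj i hi]
      simp only [this]
    · have := (hb g g.2).congr_of_eqOn (x := basisPoint L j) (y := basisPoint L j')
        fun i hi => by
          rw [basisPoint, basisPoint, hj i (by simpa using hi)]
      simp only [this]
  · rw [← ZMod.intCast_zmod_eq_zero_iff_dvd]
    have h1 := congrFun hsum (basisPoint L j)
    rw [arrayForm_basisPoint] at h1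
    push_cast
    rw [h1, ← Finset.sum_coe_sort]
    simp

/-- Arrays with biased multilinear maps modulo `q` are decomposable modulo `q`. -/
def Liftable (n q : ℕ) [NeZero q] : Prop :=
  ∀ ε : ℝ, 0 < ε → ∃ r : ℕ, ∀ (ι : Type) [Fintype ι] [DecidableEq ι] (J : ι → Type)
    [∀ i, Fintype (J i)] (L : ℕ) [NeZero L] (h : q ∣ L) (a : (∀ i, J i) → ℤ),
    Fintype.card ι = n → ε * size (fun i => J i → ZMod L) ≤
      ‖expSum (ZMod.toCircle (N := q)) (arrayForm h a)‖ → ArrayDecomp q r a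

theorem liftable_one (n : ℕ) : Liftable n 1 := fun ε _ =>
  ⟨0, fun ι _ _ J _ L _ h a _ _ => ⟨Empty, inferInstance, fun l => l.elim, fun l => l.elim,
    fun l => l.elim, by simp, fun l => l.elim, fun j => by simp⟩⟩

theorem norm_expSum_arrayForm_mono [Nonempty ι] {q q' L : ℕ} [NeZero q] [NeZero q'] [NeZero L]
    (h : q ∣ L) (h' : q' ∣ q) (a : (∀ i, J i) → ℤ) :
    ‖expSum (ZMod.toCircle (N := q)) (arrayForm h a)‖ ≤
      ‖expSum (ZMod.toCircle (N := q')) (arrayForm (h'.trans h) a)‖ := by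
  have i : ι := Classical.arbitrary ι
  rw [(isForm_arrayForm _ a).norm_expSum _ (mem_univ i),
    (isForm_arrayForm _ a).norm_expSum _ (mem_univ i)]
  refine count_mono fun x hx v => ?_
  have := hx v
  rw [toCircle_eq_one_iff] at this ⊢
  rw [← castHom_arrayForm h h', this, map_zero]

theorem exists_forms {q L : ℕ} (h : q ∣ L) (I : Finset ι) (u v : (∀ i, J i) → ℤ)
    (hu : DependsOn u I) (hv : DependsOn v (Iᶜ : Finset ι)) :
    ∃ U W : (∀ i, J i → ZMod L) → ZMod q, IsForm I U ∧ IsForm Iᶜ W ∧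
      arrayForm h (fun j => u j * v j) = U * W := by
  obtain ⟨U, W, hU, hW, hUW⟩ := exists_split (fun (i : ι) (j : J i) => coordHom h j) I
    (fun j => (u j : ZMod q)) (fun j => (v j : ZMod q)) (fun j j' hj => by simp [hu hj])
    (fun j j' hj => by simp [hv hj])
  refine ⟨_, _, isForm_restrict hU, isForm_restrict hW, funext fun x => ?_⟩
  simpa [arrayForm] using hUW x

theorem liftable_succ {n p q : ℕ} [Fact p.Prime] [NeZero q] (hn : 1 ≤ n) (hq : Liftable n q) :
    haveI : NeZero p := ⟨(Fact.out : p.Prime).ne_zero⟩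
    Liftable n (p * q) := by
  have : NeZero p := ⟨(Fact.out : p.Prime).ne_zero⟩
  intro ε hε
  have hpq : (0 : ℝ) < ((p * q : ℕ) : ℝ) := by exact_mod_cast NeZero.pos (p * q)
  obtain ⟨r₁, hr₁⟩ := good p n hn ε hε
  obtain ⟨r₂, hr₂⟩ := hq (ε / (p * q : ℕ) ^ r₁) (by positivity)
  refine ⟨r₁ + r₂, fun ι _ _ J _ L _ h a hcard hbias => ?_⟩
  have : Nonempty ι := Fintype.card_pos_iff.1 (by omega)
  have hp : p ∣ p * q := dvd_mul_right p q
  have hq' : q ∣ p * q := dvd_mul_left q p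
  obtain ⟨α, _, I, u, v, hα, hI, hdiv⟩ := arrayDecomp_of_prank (hp.trans h) a
    (hr₁ ι _ univ _ (by rw [card_univ, hcard]) (isForm_arrayForm _ a)
      (hbias.trans (norm_expSum_arrayForm_mono h hp a)))
  choose a' ha' using hdiv
  choose U W hU hW hUW using fun l => exists_forms h (I l) (u l) (v l) (hI l).2.2.1 (hI l).2.2.2
  have hsplit : arrayForm h a = arrayForm h (fun j => p * a' j) + ∑ l, U l * W l := by
    have hfun : (fun j => (a j : ZMod (p * q))) = fun j =>
        ((p * a' j : ℤ) : ZMod (p * q)) + ∑ l, ((u l j * v l j : ℤ) : ZMod (p * q)) := by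
      funext j
      rw [← Int.cast_sum, ← Int.cast_add, ← ha' j]
      simp
    funext x
    rw [arrayForm, hfun, tensorForm_add, tensorForm_sum, Pi.add_apply, Finset.sum_apply]
    refine congrArg₂ _ rfl (Finset.sum_congr rfl fun l _ => ?_)
    rw [← hUW l]
    rfl
  have hp' : expSum (ZMod.toCircle (N := p * q)) (arrayForm h (fun j => p * a' j)) =
      expSum (ZMod.toCircle (N := q)) (arrayForm (hq'.trans h) a') := by
    refine Finset.sum_congr rfl fun x _ => ?_
    have : arrayForm h (fun j => p * a' j) x = p * arrayForm h a' x := by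
      rw [arrayForm, arrayForm, ← tensorForm_mul]
      congr 1
      funext j
      push_cast
      rfl
    rw [this, toCircle_natCast_mul, castHom_arrayForm]
  have hle := norm_expSum_add_sum_mul_le (isForm_arrayForm h fun j => p * a' j) univ I U W
    (fun l _ => ⟨(hI l).1, (hI l).2.1⟩) (fun l _ => hU l) fun l _ => hW l
  rw [← hsplit, hp'] at hle
  have hbias' : ε / (p * q : ℕ) ^ r₁ * size (fun i => J i → ZMod L) ≤
      ‖expSum (ZMod.toCircle (N := q)) (arrayForm (hq'.trans h) a')‖ := by
    rw [div_mul_eq_mul_div, div_le_iff₀ (by positivity), mul_comm ‖_‖]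
    refine hbias.trans (hle.trans (mul_le_mul_of_nonneg_right ?_ (norm_nonneg _)))
    refine pow_le_pow_right₀ ?_ (by simpa using hα)
    exact_mod_cast NeZero.one_le
  obtain ⟨β, _, I', u', v', hβ, hI', hdiv'⟩ := hr₂ ι J L _ a' hcard hbias'
  refine ⟨α ⊕ β, inferInstance, Sum.elim I I', Sum.elim u fun l j => p * u' l j, Sum.elim v v', ?_,
    ?_, fun j => ?_⟩
  · rw [Fintype.card_sum]; omega
  · rintro (l | l)
    · exact hI l
    · refine ⟨(hI' l).1, (hI' l).2.1, fun j j' hj => ?_, (hI' l).2.2.2⟩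
      simp only [Sum.elim_inr, (hI' l).2.2.1 hj]
  · simp only [Fintype.sum_sum_type, Sum.elim_inl, Sum.elim_inr]
    have e : a j - (∑ l, u l j * v l j + ∑ l, p * u' l j * v' l j) =
        p * (a' j - ∑ l, u' l j * v' l j) := by
      rw [mul_sub, ← ha' j, Finset.mul_sum]
      simp only [mul_assoc]
      ring
    rw [e, Nat.cast_mul]
    exact mul_dvd_mul_left _ (hdiv' j)

theorem liftable_pow {n p : ℕ} [hp : Fact p.Prime] (hn : 1 ≤ n) (e : ℕ) (q : ℕ) [NeZero q]
    (hq : q = p ^ e) : Liftable n q := by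
  induction e generalizing q with
  | zero =>
    obtain rfl : q = 1 := hq
    convert liftable_one n
  | succ e ih =>
    have : NeZero p := ⟨hp.out.ne_zero⟩
    obtain rfl : q = p * p ^ e := by rw [hq, pow_succ']
    convert liftable_succ (p := p) hn (ih (p ^ e) rfl)

end Array

section Additive

variable {ι : Type} [Fintype ι] [dec : DecidableEq ι] {A : ι → Type} [∀ i, AddCommGroup (A i)]
  {B : Type} [AddCommGroup B]

/-- The `ℤ`-multilinear map associated with a multiadditive map. -/
def toMultilinear {φ : (∀ i, A i) → B} (hφ : IsForm univ φ) : MultilinearMap ℤ A B where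
  toFun := φ
  map_update_add' := by
    intro inst x i a b
    obtain rfl : inst = dec := Subsingleton.elim _ _
    exact hφ.1 i (mem_univ i) x a b
  map_update_smul' := by
    intro inst x i n a
    obtain rfl : inst = dec := Subsingleton.elim _ _
    exact map_zsmul (AddMonoidHom.mk' (fun y => φ (update x i y))
      (hφ.1 i (mem_univ i) x)) n a

theorem IsForm.map_sum_zsmul {φ : (∀ i, A i) → B} (hφ : IsForm univ φ) {J : ι → Type}
    [∀ i, Fintype (J i)] (n : ∀ i, J i → ℤ) (e : ∀ i, J i → A i) :
    φ (fun i => ∑ j, n i j • e i j) = ∑ r : ∀ i, J i, (∏ i, n i (r i)) • φ fun i => e i (r i) := by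
  refine ((toMultilinear hφ).map_sum fun i j => n i j • e i j).trans ?_
  exact Finset.sum_congr rfl fun r _ => (toMultilinear hφ).map_smul_univ _ _

theorem IsForm.nsmul_eq_zero {φ : (∀ i, A i) → B} (hφ : IsForm univ φ) {n : ℕ} {x : ∀ i, A i}
    {i : ι} (h : n • x i = 0) : n • φ x = 0 := by
  have h1 := map_nsmul (AddMonoidHom.mk' (fun y => φ (update x i y))
    (hφ.1 i (mem_univ i) x)) n (x i)
  rw [h, map_zero] at h1
  simpa using h1.symm

variable [∀ i, Fintype (A i)]

/-- The bias does not decrease under precomposition with homomorphisms. -/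
theorem IsForm.bias_le_comp {φ : (∀ i, A i) → B} (hφ : IsForm univ φ) (χ : AddChar B Circle)
    {C : ι → Type} [∀ i, AddCommGroup (C i)] [∀ i, Fintype (C i)] (h : ∀ i, C i →+ A i) {ε : ℝ}
    (hε : ε * size A ≤ ‖expSum χ φ‖) :
    ε * size C ≤ ‖expSum χ fun s : ∀ i, C i => φ fun i => h i (s i)‖ := by
  set θ : (∀ i, C i) → B := fun s => φ fun i => h i (s i) with hθ
  have hupd : ∀ (s : ∀ i, C i) i (a : C i),
      (fun l => h l (update s i a l)) = update (fun l => h l (s l)) i (h i a) := by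
    intro s i a
    funext l
    by_cases hl : l = i
    · subst hl; simp
    · simp [hl]
  have hθf : IsForm univ θ := isForm_univ fun i s a b => by
    simp only [hθ, hupd, map_add, hφ.1 i (mem_univ i)]
  have hfib : ∀ x : ∀ i, A i,
      ‖∑ s : ∀ i, C i, (χ (φ (fun i => h i (s i) + x i)) : ℂ)‖ ≤ ‖expSum χ θ‖ := by
    intro x
    have hsum : ∀ s : ∀ i, C i, φ (fun i => h i (s i) + x i) =
        (θ + ∑ I ∈ (univ : Finset (Finset ι)).erase univ,
          fun s : ∀ i, C i => φ (I.piecewise (fun i => h i (s i)) x)) s := by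
      intro s
      rw [Pi.add_apply, Finset.sum_apply]
      have h1 := (toMultilinear hφ).map_add_univ (fun i => h i (s i)) x
      rw [← Finset.add_sum_erase _ _ (mem_univ univ), piecewise_univ] at h1
      exact h1
    simp only [hsum]
    refine norm_expSum_add_sum_le χ hθf _ id
      (fun I (s : ∀ i, C i) => φ (I.piecewise (fun i => h i (s i)) x))
      (fun I _ => ⟨fun i hi s a b => ?_,
      fun i hi s a => congrArg φ ?_⟩) fun I hI hsub => (mem_erase.1 hI).1 (univ_subset_iff.1 hsub)
    · simp only [hupd, id] at hi ⊢
      simp only [← Finset.update_piecewise_of_mem _ _ _ hi, map_add, hφ.1 i (mem_univ i)]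
    · simp only [hupd, id] at hi ⊢
      funext l
      by_cases hl : l ∈ I
      · have hne : l ≠ i := fun h => hi (h ▸ hl)
        simp [hl, hne]
      · simp [hl]
  have hswap : (size C : ℂ) * expSum χ φ =
      ∑ x : ∀ i, A i, ∑ s : ∀ i, C i, (χ (φ (fun i => h i (s i) + x i)) : ℂ) := by
    rw [Finset.sum_comm]
    have h1 : ∀ s : ∀ i, C i, ∑ x : ∀ i, A i, (χ (φ (fun i => h i (s i) + x i)) : ℂ) =
        expSum χ φ := fun s =>
      Equiv.sum_comp (Equiv.addLeft fun i => h i (s i)) fun x => (χ (φ x) : ℂ)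
    simp only [h1, sum_const, card_univ, nsmul_eq_mul, size]
    push_cast
    rfl
  have hle : size C * ‖expSum χ φ‖ ≤ size A * ‖expSum χ θ‖ := by
    have h1 : ‖(size C : ℂ) * expSum χ φ‖ = size C * ‖expSum χ φ‖ := by
      rw [norm_mul, Complex.norm_real, Real.norm_of_nonneg size_pos.le]
    rw [← h1, hswap]
    refine (norm_sum_le _ _).trans ((Finset.sum_le_sum fun x _ => hfib x).trans ?_)
    simp [size]
  have hA : 0 < size A := size_pos
  have hC : 0 < size C := size_pos
  refine le_of_mul_le_mul_left ?_ hA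
  calc size A * (ε * size C) = size C * (ε * size A) := by ring
    _ ≤ size C * ‖expSum χ φ‖ := mul_le_mul_of_nonneg_left hε hC.le
    _ ≤ _ := hle

end Additive

/-- Biased multiadditive maps have bounded exponent. -/
theorem exists_exponent {B : Type} [AddCommGroup B] (χ : AddChar B Circle)
    (hχ : ∀ b, χ b = 1 → b = 0) (n : ℕ) (hn : 1 ≤ n) : ∀ ε : ℝ, 0 < ε → ∃ M : ℕ, 0 < M ∧
    ∀ (ι : Type) [Fintype ι] [DecidableEq ι] (V : ι → Type) [∀ i, AddCommGroup (V i)]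
      [∀ i, Fintype (V i)] (J : Finset ι) (f : (∀ i, V i) → B), J.card = n → IsForm J f →
      ε * size V ≤ ‖expSum χ f‖ → ∀ x, M • f x = 0 := by
  induction n, hn using Nat.le_induction with
  | base =>
    refine fun ε hε => ⟨1, one_pos, fun ι _ _ V _ _ J f hJ hf h x => ?_⟩
    obtain ⟨i, rfl⟩ := card_eq_one.1 hJ
    have hi : i ∈ ({i} : Finset ι) := mem_singleton_self i
    rw [hf.norm_expSum _ hi] at h
    have hpos : 0 < count (fun x : ∀ i, V i => ∀ v, χ (f (update x i v)) = 1) :=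
      (mul_pos hε size_pos).trans_le h
    rw [count_eq, Nat.cast_pos, card_pos] at hpos
    obtain ⟨y, hy⟩ := hpos
    have := hf.congr_of_eqOn (x := x) (y := update y i (x i)) (by simp)
    rw [one_smul, this]
    exact hχ _ ((mem_filter.1 hy).2 _)
  | succ n hn ih =>
    intro ε hε
    obtain ⟨M, hM, hMf⟩ := ih (ε / 2) (by positivity)
    refine ⟨M * (⌊2 / ε⌋₊).factorial, by positivity, fun ι _ _ V _ _ J f hJ hf h x => ?_⟩
    obtain ⟨i, hi⟩ : J.Nonempty := card_pos.1 (by omega)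
    have hK : (J.erase i).card = n := by rw [card_erase_of_mem hi]; omega
    let sl : V i →+ ((∀ i, V i) → B) :=
      AddMonoidHom.mk' (fun y x => f (update x i y)) (hf.slice_add hi)
    let T : AddSubgroup (V i) := (M • sl).ker
    have hT : ∀ y, y ∈ T ↔ M • sl y = 0 := fun y => AddMonoidHom.mem_ker
    have hindex := index_le_of_dense T _ (fun y hy => (hT y).2 (funext fun x =>
      hMf ι V _ _ hK (hf.slice i y) (mem_filter.1 hy).2 x)) hε (dense_slices χ i f h)
    have hdvd : T.index ∣ (⌊2 / ε⌋₊).factorial :=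
      Nat.dvd_factorial (Nat.pos_of_ne_zero AddSubgroup.index_ne_zero_of_finite)
        (Nat.le_floor hindex)
    obtain ⟨c, hc⟩ := hdvd
    have h1 := (hT _).1 (T.nsmul_mem (T.nsmul_index_mem (x i)) c)
    rw [smul_smul, mul_comm c, ← hc, map_nsmul, smul_smul] at h1
    have h2 := congrFun h1 x
    rw [Pi.smul_apply] at h2
    change _ • f (update x i (x i)) = 0 at h2
    rwa [update_eq_self] at h2

section Coordinates

/-- Coordinates on a finite abelian group. -/
theorem exists_coords (G : Type) [AddCommGroup G] [Finite G] :
    ∃ (J : Type) (_ : Fintype J) (q : J → ℕ) (e : J → G) (c : ∀ j, G →+ ZMod (q j)),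
      (∀ j, ∃ p n, p.Prime ∧ q j = p ^ n) ∧ (∀ j, q j • e j = 0) ∧
      ∀ x, ∑ j, ((c j x).val : ℤ) • e j = x := by
  obtain ⟨J, _, p, hp, n, ⟨f⟩⟩ := AddCommGroup.equiv_directSum_zmod_of_finite G
  have (j : J) : NeZero (p j ^ n j) := ⟨pow_ne_zero _ (hp j).ne_zero⟩
  let g : G ≃+ ∀ j, ZMod (p j ^ n j) := f.trans (DirectSum.addEquivProd _)
  refine ⟨J, inferInstance, fun j => p j ^ n j, fun j => g.symm (Pi.single j 1),
    fun j => (Pi.evalAddMonoidHom _ j).comp g.toAddMonoidHom, fun j => ⟨_, _, hp j, rfl⟩,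
    fun j => ?_, fun x => ?_⟩
  · rw [← map_nsmul, ← Pi.single_smul, nsmul_one, ZMod.natCast_self, Pi.single_zero, map_zero]
  · apply g.injective
    simp only [map_sum, map_zsmul, AddEquiv.apply_symm_apply]
    funext j
    rw [Finset.sum_apply, Finset.sum_eq_single j]
    · simp
    · intro j' _ hj
      simp [Pi.single_eq_of_ne hj.symm]
    · simp

theorem exists_hom {A : Type} [AddCommGroup A] {J : Type} [Fintype J] (L : ℕ) [NeZero L]
    (e : J → A) (hL : ∀ j, L • e j = 0) :
    ∃ h : (J → ZMod L) →+ A, ∀ b, ∑ j, ((b j).val : ℤ) • e j = h b := by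
  refine ⟨∑ j, (ZMod.lift L ⟨zmultiplesHom A (e j), by simpa using hL j⟩).comp
    (Pi.evalAddMonoidHom (fun _ => ZMod L) j), fun b => ?_⟩
  rw [AddMonoidHom.finsetSum_apply]
  refine Finset.sum_congr rfl fun j _ => ?_
  have h1 : b j = (((b j).val : ℤ) : ZMod L) := by simp
  rw [AddMonoidHom.comp_apply, Pi.evalAddMonoidHom_apply]
  conv_rhs => rw [h1]
  rw [ZMod.lift_coe]
  simp

theorem exists_toAddCircle_eq {g : ℕ} [NeZero g] {z : AddCircle (1 : ℝ)} (h : g • z = 0) :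
    ∃ a : ℤ, z = ZMod.toAddCircle (a : ZMod g) := by
  obtain ⟨x, rfl⟩ := QuotientAddGroup.mk_surjective z
  change ((g • x : ℝ) : AddCircle (1 : ℝ)) = 0 at h
  obtain ⟨n, hn⟩ := (AddCircle.coe_eq_zero_iff 1).1 h
  refine ⟨n, ?_⟩
  rw [ZMod.toAddCircle_intCast]
  have hg : (g : ℝ) ≠ 0 := by exact_mod_cast NeZero.ne g
  have : x = n / g := by
    rw [eq_div_iff hg, mul_comm]
    simpa using hn.symm
  rw [this]

theorem mq_eq_toAddCircle {q : ℕ} [NeZero q] (x y : ZMod q) :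
    mq q x y = ZMod.toAddCircle (x * y) := by
  have h : x * y = ((x.val * y.val : ℕ) : ZMod q) := by simp
  rw [h, ZMod.toAddCircle_natCast, mq]

variable {ι : Type} [Fintype ι] [DecidableEq ι] {J : ι → Type} [∀ i, Fintype (J i)]

theorem sum_smul_toAddCircle {g : ℕ} [NeZero g] {q : ∀ i, J i → ℕ} [∀ i j, NeZero (q i j)]
    (h : ∀ i j, g ∣ q i j) (z : ∀ i j, ZMod (q i j)) (a : (∀ i, J i) → ℤ) :
    ∑ s : ∀ i, J i, (∏ i, ((z i (s i)).val : ℤ)) • ZMod.toAddCircle (a s : ZMod g) =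
      ZMod.toAddCircle (∑ s : ∀ i, J i,
        (a s : ZMod g) * ∏ i, ZMod.castHom (h i (s i)) (ZMod g) (z i (s i))) := by
  simp only [map_sum, ← map_zsmul, zsmul_eq_mul]
  refine Finset.sum_congr rfl fun s _ => congrArg _ ?_
  push_cast
  rw [mul_comm]
  simp only [ZMod.natCast_val, ZMod.castHom_apply]

end Coordinates

section Decomposable

variable {ι : Type} [Fintype ι] [DecidableEq ι] {A : ι → Type} [∀ i, AddCommGroup (A i)]

/-- A sum of at most `r` multilinear maps factoring through `m_q`, with `q ≤ Q`. -/
def Decomposable (r Q : ℕ) (φ : (∀ i, A i) → AddCircle (1 : ℝ)) : Prop :=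
  ∃ (α : Type) (_ : Fintype α) (ψ : α → (∀ i, A i) → AddCircle (1 : ℝ)), Fintype.card α ≤ r ∧
    (∀ l, IsMultiadditive (ψ l)) ∧
    (∀ l, ∃ q : ℕ, IsPrimePow q ∧ q ≤ Q ∧ FactorsThroughMq q (ψ l)) ∧ ∀ x, φ x = ∑ l, ψ l x

theorem Decomposable.mono {r Q r' Q' : ℕ} {φ : (∀ i, A i) → AddCircle (1 : ℝ)}
    (h : Decomposable r Q φ) (hr : r ≤ r') (hQ : Q ≤ Q') : Decomposable r' Q' φ := by
  obtain ⟨α, _, ψ, hα, hψ, hq, hsum⟩ := h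
  refine ⟨α, inferInstance, ψ, hα.trans hr, hψ, fun l => ?_, hsum⟩
  obtain ⟨q, h1, h2, h3⟩ := hq l
  exact ⟨q, h1, h2.trans hQ, h3⟩

theorem decomposable_zero {φ : (∀ i, A i) → AddCircle (1 : ℝ)} (h : ∀ x, φ x = 0) (r Q : ℕ) :
    Decomposable r Q φ :=
  ⟨Empty, inferInstance, fun l => l.elim, by simp, fun l => l.elim, fun l => l.elim, by simpa⟩

theorem Decomposable.sum {β : Type} [Fintype β] {r Q : ℕ}
    {φ : β → (∀ i, A i) → AddCircle (1 : ℝ)} (h : ∀ b, Decomposable r Q (φ b)) :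
    Decomposable (Fintype.card β * r) Q fun x => ∑ b, φ b x := by
  choose α _ ψ hα hψ hq hsum using h
  refine ⟨Σ b, α b, inferInstance, fun l => ψ l.1 l.2, ?_, fun l => hψ _ _, fun l => hq _ _,
    fun x => ?_⟩
  · rw [Fintype.card_sigma]
    exact (Finset.sum_le_card_nsmul _ _ r fun b _ => hα b).trans (by simp)
  · rw [Fintype.sum_sigma]
    exact Finset.sum_congr rfl fun b _ => hsum b x

theorem decomposable_of_arrayDecomp {J : ι → Type} [∀ i, Fintype (J i)] {g r : ℕ} [NeZero g]
    (hg : IsPrimePow g) {a : (∀ i, J i) → ℤ} (ha : ArrayDecomp g r a)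
    (c : ∀ i, J i → A i →+ ZMod g) :
    Decomposable r g fun x => ZMod.toAddCircle (tensorForm c (fun j => (a j : ZMod g)) x) := by
  obtain ⟨α, _, I, u, v, hα, hI, hdvd⟩ := ha
  have hmod : (fun j => (a j : ZMod g)) =
      fun j => ∑ l, (u l j : ZMod g) * (v l j : ZMod g) := by
    funext j
    have h1 := (ZMod.intCast_zmod_eq_zero_iff_dvd _ g).2 (hdvd j)
    push_cast at h1
    exact sub_eq_zero.1 h1
  refine ⟨α, inferInstance, fun l x => ZMod.toAddCircle
    (tensorForm c (fun j => (u l j : ZMod g) * (v l j : ZMod g)) x), hα, fun l i x y z => ?_,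
    fun l => ⟨g, hg, le_rfl, I l, (hI l).1, (hI l).2.1, ?_⟩, fun x => ?_⟩
  · simp only [isMultiadditive_tensorForm c _ i x y z, map_add]
  · obtain ⟨U, W, hU, hW, h⟩ := exists_split c (I l) (fun j => (u l j : ZMod g))
      (fun j => (v l j : ZMod g)) (fun j j' hj => by simp only [(hI l).2.2.1 hj])
      (fun j j' hj => by simp only [(hI l).2.2.2 hj])
    exact ⟨U, W, hU, hW, fun x => by simp only [mq_eq_toAddCircle, h]⟩
  · simp only [hmod, tensorForm_sum, map_sum]

end Decomposable

theorem exists_rank (n : ℕ) (hn : 1 ≤ n) (g : ℕ) {ε : ℝ} (hε : 0 < ε) : ∃ r : ℕ,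
    ∀ (ι : Type) [Fintype ι] [DecidableEq ι] (A : ι → Type) [∀ i, AddCommGroup (A i)]
      [∀ i, Fintype (A i)] (J : ι → Type) [∀ i, Fintype (J i)] (q : ∀ i, J i → ℕ)
      [∀ i j, NeZero (q i j)] (e : ∀ i, J i → A i) (c : ∀ i j, A i →+ ZMod (q i j))
      (φ : (∀ i, A i) → AddCircle (1 : ℝ)), (∃ p m, p.Prime ∧ g = p ^ m) →
      Fintype.card ι = n → IsMultiadditive φ → (∀ i j, g ∣ q i j) → (∀ i j, q i j • e i j = 0) →
      (∀ s : ∀ i, J i, g • φ (fun i => e i (s i)) = 0) →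
      ε * size A ≤ ‖expSum AddCircle.toCircle_addChar φ‖ →
      Decomposable r g fun x =>
        ∑ s : ∀ i, J i, (∏ i, ((c i (s i) (x i)).val : ℤ)) • φ fun i => e i (s i) := by
  by_cases hg : IsPrimePow g
  · obtain ⟨p, m, hp, -, hpm⟩ := (isPrimePow_nat_iff g).1 hg
    have : Fact p.Prime := ⟨hp⟩
    have : NeZero g := ⟨hg.ne_zero⟩
    obtain ⟨r, hr⟩ := liftable_pow (p := p) hn m g hpm.symm ε hε
    refine ⟨r, fun ι _ _ A _ _ J _ q _ e c φ _ hcard hφ hgq he htor hbias => ?_⟩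
    choose a ha using fun s => exists_toAddCircle_eq (htor s)
    let L : ℕ := g * ∏ i, ∏ j, q i j
    have : NeZero L := ⟨mul_ne_zero (NeZero.ne g)
      (prod_ne_zero_iff.2 fun i _ => prod_ne_zero_iff.2 fun j _ => NeZero.ne _)⟩
    have hL : ∀ i j, L • e i j = 0 := fun i j => by
      obtain ⟨d, hd⟩ : q i j ∣ L := ((dvd_prod_of_mem _ (mem_univ j)).trans
        (dvd_prod_of_mem (fun i => ∏ j, q i j) (mem_univ i))).mul_left g
      rw [hd, mul_comm, mul_smul, he, smul_zero]
    choose h hh using fun i => exists_hom L (e i) (hL i)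
    have hform := isForm_univ hφ
    have hcomp : ∀ b : ∀ i, J i → ZMod L,
        φ (fun i => h i (b i)) = ZMod.toAddCircle (arrayForm (dvd_mul_right g _) a b) := by
      intro b
      simp only [← hh]
      rw [hform.map_sum_zsmul (fun i j => ((b i j).val : ℤ)) e]
      simp only [ha]
      exact sum_smul_toAddCircle (q := fun _ _ => L) (fun _ _ => dvd_mul_right g _) b a
    have hdec := hr ι J L (dvd_mul_right g _) a hcard
      ((hform.bias_le_comp _ h hbias).trans_eq (by simp only [hcomp]; rfl))
    convert decomposable_of_arrayDecomp hg hdec fun i j =>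
      (ZMod.castHom (hgq i j) (ZMod g)).toAddMonoidHom.comp (c i j) using 2 with x
    simp only [ha]
    exact sum_smul_toAddCircle hgq (fun i j => c i j (x i)) a
  · refine ⟨0, fun ι _ _ A _ _ J _ q _ e c φ ⟨p, m, hp, hpm⟩ _ _ _ _ htor _ =>
      decomposable_zero (fun x => Finset.sum_eq_zero fun s _ => ?_) _ _⟩
    obtain rfl : m = 0 := by
      by_contra hm
      exact hg ((isPrimePow_nat_iff g).2 ⟨p, m, hp, Nat.pos_of_ne_zero hm, hpm.symm⟩)
    have h1 := htor s
    rw [hpm, pow_zero, one_smul] at h1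
    rw [h1, smul_zero]

theorem le_norm_expSum_of_le_bias {ι : Type} [Fintype ι] [DecidableEq ι] {A : ι → Type}
    [∀ i, AddCommGroup (A i)] [∀ i, Fintype (A i)] {φ : (∀ i, A i) → AddCircle (1 : ℝ)} {ε : ℝ}
    (h : (ε : ℂ) ≤ bias φ) : ε * size A ≤ ‖expSum AddCircle.toCircle_addChar φ‖ := by
  have h1 : ε ≤ ‖bias φ‖ := by
    have := (Complex.le_def.1 h).1
    rw [Complex.ofReal_re] at this
    exact this.trans (Complex.re_le_norm _)
  have h2 : bias φ = expSum AddCircle.toCircle_addChar φ / (size A : ℂ) := by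
    simp only [bias, expSum, size, Complex.ofReal_natCast]
    rfl
  rwa [h2, norm_div, Complex.norm_real, Real.norm_of_nonneg size_pos.le,
    le_div_iff₀ size_pos] at h1

theorem exists_decomposable (k : ℕ) (hk : 1 ≤ k) {ε : ℝ} (hε : 0 < ε) :
    ∃ r Q : ℕ, ∀ (ι : Type) [Fintype ι] [DecidableEq ι] (A : ι → Type) [∀ i, AddCommGroup (A i)]
      [∀ i, Fintype (A i)] (φ : (∀ i, A i) → AddCircle (1 : ℝ)), Fintype.card ι = k →
      IsMultiadditive φ → ε * size A ≤ ‖expSum AddCircle.toCircle_addChar φ‖ →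
      Decomposable r Q φ := by
  obtain ⟨M, hM, hexp⟩ := exists_exponent (AddCircle.toCircle_addChar (T := (1 : ℝ)))
    (fun b hb => AddCircle.injective_toCircle one_ne_zero
      (hb.trans AddCircle.toCircle_zero.symm)) k hk ε hε
  choose r hr using fun g => exists_rank k hk g hε
  refine ⟨(M + 1) ^ k * ∑ g ∈ range (M + 1), r g, M, fun ι _ _ A _ _ φ hcard hφ hbias => ?_⟩
  have hform := isForm_univ hφ
  have htor := hexp ι A univ φ (by rwa [card_univ]) hform hbias
  choose J _ q e c hq he hx using fun i => exists_coords (A i)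
  have (i : ι) (j : J i) : NeZero (q i j) := by
    obtain ⟨p, n, hp, h⟩ := hq i j
    exact ⟨h ▸ pow_ne_zero _ hp.ne_zero⟩
  let τ : ∀ i, J i → Fin (M + 1) := fun i j =>
    ⟨M.gcd (q i j), Nat.lt_succ_of_le (Nat.le_of_dvd hM (Nat.gcd_dvd_left _ _))⟩
  have hsplit : φ = fun x => ∑ σ : ι → Fin (M + 1), ∑ s : ∀ i, {j // τ i j = σ i},
      (∏ i, ((c i (s i).1 (x i)).val : ℤ)) • φ fun i => e i (s i).1 := by
    funext x
    have h1 := hform.map_sum_zsmul (fun i j => ((c i j (x i)).val : ℤ)) e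
    simp only [hx] at h1
    rw [h1, ← Finset.sum_fiberwise univ fun s i => τ i (s i)]
    refine Finset.sum_congr rfl fun σ _ => Eq.symm ?_
    refine Finset.sum_bij (fun s _ i => (s i).1) (fun s _ => ?_) (fun s _ s' _ h => ?_)
      (fun s hs => ?_) fun s _ => rfl
    · exact mem_filter.2 ⟨mem_univ _, funext fun i => (s i).2⟩
    · exact funext fun i => Subtype.ext (congrFun h i)
    · exact ⟨fun i => ⟨s i, congrFun (mem_filter.1 hs).2 i⟩, mem_univ _, rfl⟩
  have hcol : Fintype.card (ι → Fin (M + 1)) = (M + 1) ^ k := by simp [hcard]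
  rw [hsplit, ← hcol]
  refine Decomposable.sum fun σ => ?_
  rcases isEmpty_or_nonempty (∀ i, {j // τ i j = σ i}) with hempty | ⟨⟨t⟩⟩
  · exact decomposable_zero (fun x => by simp) _ _
  · have hσ : ∀ i (j : {j // τ i j = σ i}), (σ i : ℕ) = M.gcd (q i j.1) := fun i j =>
      (congrArg Fin.val j.2).symm
    let g : ℕ := univ.gcd fun i => (σ i : ℕ)
    have hgσ : ∀ i, g ∣ (σ i : ℕ) := fun i => Finset.gcd_dvd (mem_univ i)
    have hgq : ∀ i (j : {j // τ i j = σ i}), g ∣ q i j.1 := fun i j =>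
      ((hgσ i).trans (hσ i j).dvd).trans (Nat.gcd_dvd_right _ _)
    obtain ⟨i₀⟩ : Nonempty ι := Fintype.card_pos_iff.1 (by omega)
    have hgM : g ≤ M := Nat.le_of_dvd hM
      (((hgσ i₀).trans (hσ i₀ (t i₀)).dvd).trans (Nat.gcd_dvd_left _ _))
    have hgp : ∃ p m, p.Prime ∧ g = p ^ m := by
      obtain ⟨p, n, hp, h⟩ := hq i₀ (t i₀)
      obtain ⟨m, -, hm⟩ := (Nat.dvd_prime_pow hp).1 (h ▸ hgq i₀ (t i₀))
      exact ⟨p, m, hp, hm⟩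
    have hφg : ∀ s : ∀ i, {j // τ i j = σ i}, g • φ (fun i => e i (s i).1) = 0 := fun s => by
      refine addOrderOf_dvd_iff_nsmul_eq_zero.1 (Finset.dvd_gcd fun i _ => ?_)
      rw [hσ i (s i)]
      exact Nat.dvd_gcd (addOrderOf_dvd_iff_nsmul_eq_zero.2 (htor _))
        (addOrderOf_dvd_iff_nsmul_eq_zero.2 (hform.nsmul_eq_zero (i := i) (he i _)))
    refine (hr g ι A (fun i => {j // τ i j = σ i}) (fun i j => q i j.1) (fun i j => e i j.1)
      (fun i j => c i j.1) φ hgp hcard hφ hgq (fun i j => he i _) hφg hbias).mono ?_ hgM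
    exact Finset.single_le_sum (f := r) (fun _ _ => Nat.zero_le _)
      (mem_range.2 (Nat.lt_succ_of_le hgM))

end BiasInverse
/-- **Theorem (bias inverse theorem).** For every `k ≥ 1` and `ε > 0` there are constants
`r = r(k, ε)` and `Q = Q(k, ε)` such that: if `A_1, …, A_k` are finite abelian groups and
`φ : A_1 × ⋯ × A_k → ℝ/ℤ` is a multilinear map with `bias(φ) ≥ ε`, then `φ` is the sum of
at most `r` multilinear maps, each factoring through `m_q` for some prime power `q ≤ Q`. -/
theorem bias_inverse_theorem (k : ℕ) (hk : 1 ≤ k) (ε : ℝ) (hε : 0 < ε) :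
    ∃ r Q : ℕ, ∀ (A : Fin k → Type) (_ : ∀ i, AddCommGroup (A i)) (_ : ∀ i, Fintype (A i))
      (φ : (∀ i, A i) → AddCircle (1 : ℝ)), IsMultiadditive φ → (ε : ℂ) ≤ bias φ →
      ∃ (m : ℕ) (_ : m ≤ r) (ψ : Fin m → ((∀ i, A i) → AddCircle (1 : ℝ))),
        (∀ j, IsMultiadditive (ψ j)) ∧
        (∀ j, ∃ q : ℕ, IsPrimePow q ∧ q ≤ Q ∧ FactorsThroughMq q (ψ j)) ∧
        (∀ x, φ x = ∑ j, ψ j x) := by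
  obtain ⟨r, Q, h⟩ := BiasInverse.exists_decomposable k hk hε
  refine ⟨r, Q, fun A _ _ φ hφ hbias => ?_⟩
  obtain ⟨α, _, ψ, hα, hψ, hq, hsum⟩ := h (Fin k) A φ (Fintype.card_fin k) hφ
    (BiasInverse.le_norm_expSum_of_le_bias hbias)
  exact ⟨Fintype.card α, hα, fun j => ψ ((Fintype.equivFin α).symm j), fun j => hψ _,
    fun j => hq _, fun x => (hsum x).trans ((Fintype.equivFin α).symm.sum_comp _).symm⟩
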